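/- Let G and H be modules over Z_p (the integers localized at a prime p) with partial decomposition bases C and C' respectively, each closed under taking subsets and nonzero scalar multiples of their elements. Suppose û(α,G) = û(α,H) for every α that is an ordinal or ∞, and ŵ(e,G) = ŵ(e,H) for every equivalence class e of Ulm sequences. Let X₀ ∈ C, Y₀ ∈ C', and let f₀ : X₀ → Y₀ be a bijection with U(x) = U(f₀(x)) for all x ∈ X₀. Then the set I of all maps f : S → T for which there exist X ∈ C and Y ∈ C' with: (i) S and T finitely generated submodules of G and H respectively; (ii) f a height-preserving isomorphism; (iii) X ⊆ S ⊆ ⟨X⟩⁰ and Y ⊆ T ⊆ ⟨Y⟩⁰; (iv) f(X) = Y; and (v) X₀ ⊆ X and f restricted to X₀ equals f₀ — is a nonempty set of isomorphisms with the back-and-forth property, hence witnesses G ≅_p H. -/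

import Mathlib

noncomputable section

namespace UlmW

universe u

variable {R : Type*} [CommRing R]

/-- The submodule `p^α M`, defined by transfinite recursion on `α`. -/
def ppow {M : Type u} [AddCommGroup M] [Module R M] (p : R) (α : Ordinal.{u}) :
    Submodule R M :=
  Ordinal.limitRecOn α ⊤ (fun _ S => Submodule.map (LinearMap.lsmul R M p) S)
    fun β _ ih => ⨅ (γ : Set.Iio β), ih γ.1 γ.2

open scoped Classical in
/-- The `p`-height of `x`, with `⊤` playing the role of `∞`. -/
def pheight {M : Type u} [AddCommGroup M] [Module R M] (p : R) (x : M) :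
    WithTop Ordinal.{u} :=
  if h : ∃ α : Ordinal.{u}, x ∈ ppow p α ∧ x ∉ ppow p (α + 1) then (h.choose : WithTop Ordinal)
  else ⊤

/-- `H⁰ = {x : ∃ a ≠ 0, a • x ∈ H}`. -/
def hull {M : Type u} [AddCommGroup M] [Module R M] (H : Submodule R M) : Set M :=
  {x | ∃ a : R, a ≠ 0 ∧ a • x ∈ H}

/-- `X` is a decomposition set with respect to the single prime `p`. -/
def IsDecompWrt {M : Type u} [AddCommGroup M] [Module R M] (p : R) (X : Set M) : Prop :=
  (LinearIndependent R (fun x : X => (x : M))) ∧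
  (∀ x ∈ X, ∀ a : R, a ≠ 0 → a • x ≠ 0) ∧
  (∀ s : Finset M, ↑s ⊆ X → ∀ c : M → R,
    pheight p (∑ x ∈ s, c x • x) = s.inf fun x => pheight p (c x • x))

/-- `X` is a decomposition set (with respect to every prime of `R`). -/
def IsDecompositionSet (R : Type*) [CommRing R] {M : Type u} [AddCommGroup M] [Module R M]
    (X : Set M) : Prop :=
  ∀ p : R, Prime p → IsDecompWrt p X

/-- partial decomposition basis, heights taken w.r.t. a fixed prime `p`. -/
def IsPDBWrt {M : Type u} [AddCommGroup M] [Module R M] (p : R) (C : Set (Set M)) : Prop :=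
  C.Nonempty ∧ (∀ X ∈ C, X.Finite) ∧ (∀ X ∈ C, IsDecompWrt p X) ∧
  ∀ X ∈ C, ∀ x : M, ∃ Y ∈ C, X ⊆ Y ∧ x ∈ hull (Submodule.span R Y)

/-- partial decomposition basis (heights w.r.t. all primes of `R`). -/
def IsPDB (R : Type*) [CommRing R] {M : Type u} [AddCommGroup M] [Module R M] (C : Set (Set M)) : Prop :=
  C.Nonempty ∧ (∀ X ∈ C, X.Finite) ∧ (∀ X ∈ C, IsDecompositionSet R X) ∧
  ∀ X ∈ C, ∀ x : M, ∃ Y ∈ C, X ⊆ Y ∧ x ∈ hull (Submodule.span R Y)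

/-- A partial isomorphism system `I : G ≅_p H`. -/
def IsPartialIsoSystem {M N : Type*} [AddCommGroup M] [Module R M]
    [AddCommGroup N] [Module R N] (I : Set (M →ₗ.[R] N)) : Prop :=
  I.Nonempty ∧
  (∀ f ∈ I, Function.Injective f.toFun) ∧
  (∀ f ∈ I, ∀ a : M, ∃ g ∈ I, f ≤ g ∧ a ∈ g.domain) ∧
  (∀ f ∈ I, ∀ b : N, ∃ g ∈ I, f ≤ g ∧ ∃ y : g.domain, g y = b)

/-- The Ulm sequence of `x`: `U(x) = (|pⁱ x|)ᵢ`. -/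
def UlmSeqOf {M : Type u} [AddCommGroup M] [Module R M] (p : R) (x : M) :
    ℕ → WithTop Ordinal.{u} :=
  fun i => pheight p ((p ^ i) • x)

/-- `u` is an Ulm sequence. -/
def IsUlmSeq (u : ℕ → WithTop Ordinal.{u}) : Prop :=
  ∀ i, (u i = ⊤ → u (i + 1) = ⊤) ∧ (u i ≠ ⊤ → u i < u (i + 1))

/-- Equivalence of Ulm sequences. -/
def UlmEquiv (u v : ℕ → WithTop Ordinal.{u}) : Prop :=
  ∃ m n : ℕ, ∀ i, u (i + n) = v (i + m)

/-- `X` contains at least `n` elements whose Ulm sequence is equivalent to `u`. -/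
def HasAtLeast {M : Type u} [AddCommGroup M] [Module R M] (p : R)
    (u : ℕ → WithTop Ordinal.{u}) (n : ℕ) (X : Set M) : Prop :=
  ∃ s : Finset M, ↑s ⊆ X ∧ n ≤ s.card ∧ ∀ x ∈ s, UlmEquiv (UlmSeqOf p x) u

/-- `ŵ_C(e,G)` where `e` is the class of the Ulm sequence `u`. -/
def wHat {M : Type u} [AddCommGroup M] [Module R M] (p : R) (C : Set (Set M))
    (u : ℕ → WithTop Ordinal.{u}) : ℕ∞ :=
  sSup {N : ℕ∞ | ∃ n : ℕ, N = (n : ℕ∞) ∧ ∃ X ∈ C, HasAtLeast p u n X}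

/-- `x` is proper with respect to `S`. -/
def IsProper {M : Type u} [AddCommGroup M] [Module R M] (p : R) (S : Submodule R M)
    (x : M) : Prop :=
  ∀ s ∈ S, pheight p (x + s) ≤ pheight p x

/-- `H` is a nice submodule. -/
def IsNice {M : Type u} [AddCommGroup M] [Module R M] (p : R) (H : Submodule R M) : Prop :=
  ∀ x : M, ∃ h ∈ H, ∀ h' ∈ H, pheight p (x + h') ≤ pheight p (x + h)

/-- The Ulm invariant `u_p(σ, M)`: the dimension of `(p^σ M)[p]/(p^{σ+1} M)[p]`
over the residue field `R/(p)`. -/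
def uCard (p : R) (M : Type u) [AddCommGroup M] [Module R M] (σ : Ordinal.{u}) :
    Cardinal :=
  let V : Submodule R M := ppow p σ ⊓ Submodule.torsionBy R M p
  let W : Submodule R V := (ppow p (σ + 1) ⊓ Submodule.torsionBy R M p).comap V.subtype
  Module.rank (R ⧸ Ideal.span {p})
    ((V ⧸ W) ⧸ (Ideal.span {p} • (⊤ : Submodule R (V ⧸ W))))

/-- `û_p(σ, M) = min (u_p(σ, M), ω)`. -/
def uHat (p : R) (M : Type u) [AddCommGroup M] [Module R M] (σ : Ordinal.{u}) : Cardinal :=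
  min (uCard p M σ) Cardinal.aleph0

/-- `û_p(∞, M) = min (dim (p^∞ M)[p], ω)`. -/
def uHatInf (p : R) (M : Type u) [AddCommGroup M] [Module R M] : Cardinal :=
  let V : Submodule R M := (⨅ α : Ordinal.{u}, ppow p α) ⊓ Submodule.torsionBy R M p
  min (Module.rank (R ⧸ Ideal.span {p})
    (V ⧸ (Ideal.span {p} • (⊤ : Submodule R V)))) Cardinal.aleph0

end UlmW

open UlmW

/-- The ideal `(p) ⊆ ℤ` is prime. -/
instance zpSpanPrime (p : ℤ) [hp : Fact (Prime p)] : (Ideal.span {p} : Ideal ℤ).IsPrime :=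
  (Ideal.span_singleton_prime hp.out.ne_zero).mpr hp.out

/-- `ℤ_(p)`, the integers localized at the prime `p`. -/
abbrev Zp (p : ℤ) [Fact (Prime p)] : Type :=
  Localization.AtPrime (Ideal.span {p} : Ideal ℤ)

namespace UlmW

universe u v

section Height

variable {R : Type v} [CommRing R] {M : Type u} [AddCommGroup M] [Module R M] {p : R}

theorem ppow_zero : ppow (M := M) p 0 = ⊤ := by
  simp [ppow]

theorem ppow_add_one (α : Ordinal.{u}) :
    ppow (M := M) p (α + 1) = Submodule.map (LinearMap.lsmul R M p) (ppow p α) := by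
  simp [ppow]

theorem ppow_limit {α : Ordinal.{u}} (h : Order.IsSuccLimit α) :
    ppow (M := M) p α = ⨅ γ : Set.Iio α, ppow p γ.1 := by
  simp only [ppow]
  rw [Ordinal.limitRecOn_limit _ _ _ _ h]

theorem mem_ppow_add_one {α : Ordinal.{u}} {x : M} :
    x ∈ ppow p (α + 1) ↔ ∃ g ∈ ppow p α, p • g = x := by
  simp [ppow_add_one]

theorem ppow_add_one_le (α : Ordinal.{u}) : ppow (M := M) p (α + 1) ≤ ppow p α := by
  intro x hx
  obtain ⟨g, hg, rfl⟩ := mem_ppow_add_one.1 hx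
  exact Submodule.smul_mem _ _ hg

theorem ppow_anti : Antitone (ppow (M := M) p) := by
  intro α β h
  induction β using Ordinal.limitRecOn with
  | zero =>
    obtain rfl : α = 0 := by simpa using h
    exact le_rfl
  | add_one β ih =>
    rcases h.eq_or_lt with rfl | h
    · exact le_rfl
    · exact (ppow_add_one_le β).trans (ih (Order.lt_add_one_iff.1 h))
  | limit β hβ ih =>
    rcases h.eq_or_lt with rfl | h
    · exact le_rfl
    · rw [ppow_limit hβ]
      exact iInf_le (fun γ : Set.Iio β => ppow (M := M) p γ.1) ⟨α, h⟩

theorem exists_height_of_notMem {x : M} {β : Ordinal.{u}} (h : x ∉ ppow p β) :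
    ∃ α < β, x ∈ ppow p α ∧ x ∉ ppow p (α + 1) := by
  induction β using Ordinal.limitRecOn with
  | zero => simp [ppow_zero] at h
  | add_one β ih =>
    by_cases hx : x ∈ ppow p β
    · exact ⟨β, Order.lt_add_one_iff.2 le_rfl, hx, h⟩
    · obtain ⟨α, hα, h'⟩ := ih hx
      exact ⟨α, hα.trans (Order.lt_add_one_iff.2 le_rfl), h'⟩
  | limit β hβ ih =>
    rw [ppow_limit hβ, Submodule.mem_iInf] at h
    push Not at h
    obtain ⟨γ, hγ⟩ := h
    obtain ⟨α, hα, h'⟩ := ih γ.1 γ.2 hγ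
    exact ⟨α, hα.trans γ.2, h'⟩

theorem coe_le_pheight {x : M} {α : Ordinal.{u}} :
    (α : WithTop Ordinal.{u}) ≤ pheight p x ↔ x ∈ ppow p α := by
  unfold pheight
  split_ifs with h
  · have hc := h.choose_spec
    rw [WithTop.coe_le_coe]
    constructor
    · intro hle
      exact ppow_anti hle hc.1
    · intro hx
      by_contra hlt
      exact hc.2 (ppow_anti (Order.add_one_le_of_lt (not_le.1 hlt)) hx)
  · simp only [le_top, true_iff]
    by_contra hx
    obtain ⟨β, -, hβ⟩ := exists_height_of_notMem hx
    exact h ⟨β, hβ⟩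

theorem le_pheight_iff {x : M} {h : WithTop Ordinal.{u}} :
    h ≤ pheight p x ↔ ∀ α : Ordinal.{u}, (α : WithTop Ordinal.{u}) ≤ h → x ∈ ppow p α := by
  constructor
  · intro hx α hα
    exact coe_le_pheight.1 (hα.trans hx)
  · intro hx
    induction h with
    | coe α => exact coe_le_pheight.2 (hx α le_rfl)
    | top =>
      by_contra hlt
      rw [top_le_iff] at hlt
      lift pheight p x to Ordinal.{u} using hlt with β hβ
      have h1 := coe_le_pheight.2 (hx (β + 1) le_top)
      rw [← hβ, WithTop.coe_le_coe] at h1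
      exact absurd h1 (not_le.2 (Order.lt_add_one_iff.2 le_rfl))

theorem coe_lt_pheight {x : M} {α : Ordinal.{u}} :
    (α : WithTop Ordinal.{u}) < pheight p x ↔ x ∈ ppow p (α + 1) := by
  rw [← coe_le_pheight]
  induction pheight p x with
  | coe β =>
    rw [WithTop.coe_lt_coe, WithTop.coe_le_coe]
    exact Order.add_one_le_iff.symm
  | top => simp

@[simp]
theorem pheight_zero : pheight p (0 : M) = ⊤ :=
  top_le_iff.1 (le_pheight_iff.2 fun _ _ => zero_mem _)

theorem le_pheight_add {x y : M} {h : WithTop Ordinal.{u}} (hx : h ≤ pheight p x)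
    (hy : h ≤ pheight p y) : h ≤ pheight p (x + y) :=
  le_pheight_iff.2 fun α hα => add_mem (le_pheight_iff.1 hx α hα) (le_pheight_iff.1 hy α hα)

theorem pheight_le_smul (r : R) (x : M) : pheight p x ≤ pheight p (r • x) :=
  le_pheight_iff.2 fun _ hα => Submodule.smul_mem _ _ (coe_le_pheight.1 hα)

theorem pheight_smul_le_of_dvd {a b : R} (h : a ∣ b) (x : M) :
    pheight p (a • x) ≤ pheight p (b • x) := by
  obtain ⟨c, rfl⟩ := h
  rw [mul_comm, mul_smul]
  exact pheight_le_smul _ _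

theorem pheight_smul_of_associated {a b : R} (h : Associated a b) (x : M) :
    pheight p (a • x) = pheight p (b • x) :=
  le_antisymm (pheight_smul_le_of_dvd h.dvd x) (pheight_smul_le_of_dvd h.symm.dvd x)

theorem pheight_smul_of_isUnit {a : R} (h : IsUnit a) (x : M) :
    pheight p (a • x) = pheight p x := by
  have := pheight_smul_of_associated (p := p) (associated_one_iff_isUnit.2 h) x
  rwa [one_smul] at this

@[simp]
theorem pheight_neg (x : M) : pheight p (-x) = pheight p x := by
  rw [← neg_one_smul R x]
  exact pheight_smul_of_isUnit isUnit_one.neg x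

theorem le_pheight_sub {x y : M} {h : WithTop Ordinal.{u}} (hx : h ≤ pheight p x)
    (hy : h ≤ pheight p y) : h ≤ pheight p (x - y) := by
  rw [sub_eq_add_neg]
  exact le_pheight_add hx (by rwa [pheight_neg])

theorem lt_pheight_sub {x y : M} {h : WithTop Ordinal.{u}} (hx : h < pheight p x)
    (hy : h < pheight p y) : h < pheight p (x - y) :=
  (lt_min hx hy).trans_le (le_pheight_sub (min_le_left _ _) (min_le_right _ _))

theorem pheight_add_eq_min {x y : M} (h : pheight p (x + y) ≤ pheight p x) :
    pheight p (x + y) = min (pheight p x) (pheight p y) := by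
  refine le_antisymm (le_min h ?_) (le_pheight_add (min_le_left _ _) (min_le_right _ _))
  have := le_pheight_sub le_rfl h
  rwa [add_sub_cancel_left] at this

theorem pheight_lt_smul {x : M} (h : pheight p x ≠ ⊤) : pheight p x < pheight p (p • x) := by
  lift pheight p x to Ordinal.{u} using h with α hα
  rw [coe_lt_pheight, mem_ppow_add_one]
  exact ⟨x, coe_le_pheight.1 hα.le, rfl⟩

theorem exists_pheight_eq_top {x : M} (h : pheight p x = ⊤) :
    ∃ g : M, pheight p g = ⊤ ∧ p • g = x := by
  let β : Ordinal.{u} := ⨆ g : M, ((pheight p g).untopD 0 + 1)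
  have hx : x ∈ ppow p (β + 1) := coe_le_pheight.1 (h ▸ le_top)
  obtain ⟨g, hg, rfl⟩ := mem_ppow_add_one.1 hx
  refine ⟨g, ?_, rfl⟩
  by_contra hne
  have h1 := Ordinal.le_iSup (fun g : M => (pheight p g).untopD 0 + 1) g
  have h2 := coe_le_pheight.2 hg
  change (pheight p g).untopD 0 + 1 ≤ β at h1
  lift pheight p g to Ordinal.{u} using hne with α
  rw [WithTop.coe_le_coe] at h2
  exact absurd (h1.trans h2) (not_le.2 (Order.lt_add_one_iff.2 le_rfl))

theorem isUlmSeq_ulmSeqOf (x : M) : IsUlmSeq (UlmSeqOf p x) := by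
  intro i
  simp only [UlmSeqOf, pow_succ', mul_smul]
  refine ⟨fun h => top_le_iff.1 (h ▸ pheight_le_smul _ _), pheight_lt_smul⟩

end Height

section UlmEquiv

theorem UlmEquiv.refl (u : ℕ → WithTop Ordinal.{u}) : UlmEquiv u u := ⟨0, 0, fun _ => rfl⟩

theorem UlmEquiv.symm {u v : ℕ → WithTop Ordinal.{u}} (h : UlmEquiv u v) : UlmEquiv v u := by
  obtain ⟨m, n, h⟩ := h
  exact ⟨n, m, fun i => (h i).symm⟩

theorem UlmEquiv.trans {u v w : ℕ → WithTop Ordinal.{u}} (h : UlmEquiv u v)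
    (h' : UlmEquiv v w) : UlmEquiv u w := by
  obtain ⟨m, n, h⟩ := h
  obtain ⟨m', n', h'⟩ := h'
  refine ⟨m + m', n + n', fun i => ?_⟩
  have h1 := h (i + n')
  have h2 := h' (i + m)
  rw [show i + (n + n') = i + n' + n by ring, h1, show i + n' + m = i + m + n' by ring, h2]
  congr 1; ring

end UlmEquiv

section Decomposition

variable {R : Type v} [CommRing R] {M : Type u} [AddCommGroup M] [Module R M] {p : R}

theorem IsDecompWrt.le_pheight_sum_iff {X : Set M} [Fintype X] (hX : IsDecompWrt p X) (c : X → R)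
    {h : WithTop Ordinal.{u}} :
    h ≤ pheight p (∑ i, c i • (i : M)) ↔ ∀ i, h ≤ pheight p (c i • (i : M)) := by
  classical
  let c' : M → R := fun m => if hm : m ∈ X then c ⟨m, hm⟩ else 0
  have hc' : ∀ i : X, c' i = c i := fun i => by simp [c']
  have h1 := hX.2.2 X.toFinset (by simp) c'
  rw [← Finset.sum_set_coe X] at h1
  simp only [hc'] at h1
  rw [h1, Finset.le_inf_iff]
  simp only [Set.mem_toFinset]
  constructor
  · intro hb i
    simpa [hc'] using hb i i.2
  · intro hb m hm
    simpa [hc' ⟨m, hm⟩] using hb ⟨m, hm⟩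

theorem IsDecompWrt.pheight_sum_le {X : Set M} [Fintype X] (hX : IsDecompWrt p X) (c : X → R)
    (i : X) : pheight p (∑ i, c i • (i : M)) ≤ pheight p (c i • (i : M)) :=
  (hX.le_pheight_sum_iff c).1 le_rfl i

theorem mem_span_iff_exists_sum {X : Set M} [Fintype X] {x : M} :
    x ∈ Submodule.span R X ↔ ∃ c : X → R, ∑ i, c i • (i : M) = x := by
  rw [← Submodule.mem_span_range_iff_exists_fun R, Subtype.range_coe]

theorem exists_sum_insert_eq {X : Set M} (hXf : X.Finite) {x : M} (hx : x ∉ X)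
    [Fintype ↥(insert x X)] {w : M} (hw : w ∈ Submodule.span R X) (r : R) :
    ∃ c : ↥(insert x X) → R, ∑ i, c i • (i : M) = w + r • x ∧ c ⟨x, Set.mem_insert _ _⟩ = r := by
  classical
  have := hXf.fintype
  obtain ⟨c, rfl⟩ := mem_span_iff_exists_sum.1 hw
  refine ⟨fun i => if hi : (i : M) ∈ X then c ⟨i, hi⟩ else r, ?_, by simp [hx]⟩
  rw [Finset.sum_set_coe (insert x X) (f := fun m => (if hi : m ∈ X then c ⟨m, hi⟩ else r) • m),
    Set.toFinset_insert, Finset.sum_insert (by simpa), ← Finset.sum_set_coe X]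
  simp [hx, add_comm]

/-- Heights in an independent sum `⟨X⟩ ⊕ ⟨x⟩` are bounded by those of the `x`-component. -/
theorem IsDecompWrt.pheight_add_smul_le {X : Set M} (hXf : X.Finite) {x : M} (hx : x ∉ X)
    (hX : IsDecompWrt p (insert x X)) {w : M} (hw : w ∈ Submodule.span R X) (r : R) :
    pheight p (w + r • x) ≤ pheight p (r • x) := by
  have := (hXf.insert x).fintype
  obtain ⟨c, h, hc⟩ := exists_sum_insert_eq hXf hx hw r
  rw [← h]
  simpa [hc] using hX.pheight_sum_le c ⟨x, Set.mem_insert _ _⟩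

theorem IsDecompWrt.eq_zero_of_add_smul_eq_zero {X : Set M} (hXf : X.Finite) {x : M} (hx : x ∉ X)
    (hX : IsDecompWrt p (insert x X)) {w : M} (hw : w ∈ Submodule.span R X) {r : R}
    (h : w + r • x = 0) : r = 0 := by
  have := (hXf.insert x).fintype
  obtain ⟨c, h', hc⟩ := exists_sum_insert_eq hXf hx hw r
  exact hc.symm.trans (Fintype.linearIndependent_iff.1 hX.1 c (h'.trans h) _)

end Decomposition

section Hull

variable {R : Type v} [CommRing R]
  {M : Type u} [AddCommGroup M] [Module R M] {p : R}

theorem pow_smul_mem_of_le {L : Submodule R M} {x : M} {k n : ℕ} (h : p ^ k • x ∈ L)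
    (hkn : k ≤ n) : p ^ n • x ∈ L := by
  rw [← Nat.sub_add_cancel hkn, pow_add, mul_smul]
  exact L.smul_mem _ h

theorem hull_mono {L L' : Submodule R M} (h : L ≤ L') : hull L ⊆ hull L' :=
  fun _ ⟨a, ha, hx⟩ => ⟨a, ha, h hx⟩

theorem smul_mem_hull {L : Submodule R M} {x : M} (r : R) (hx : x ∈ hull L) : r • x ∈ hull L := by
  obtain ⟨a, ha, h⟩ := hx
  exact ⟨a, ha, by rw [smul_comm]; exact L.smul_mem _ h⟩

/-- A finite set of representatives modulo `p ^ k`. -/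
theorem exists_finite_residues [Finite (R ⧸ Ideal.span {p})] (k : ℕ) :
    ∃ F : Set R, F.Finite ∧ ∀ r, ∃ r' ∈ F, p ^ k ∣ r' - r := by
  have h : Finite (R ⧸ Ideal.span {p} ^ k) :=
    Ideal.finite_quotient_pow (Submodule.fg_span_singleton p) k
  refine ⟨Set.range (Quotient.out : R ⧸ Ideal.span {p} ^ k → R), Set.finite_range _, fun r => ?_⟩
  refine ⟨_, ⟨Ideal.Quotient.mk _ r, rfl⟩, ?_⟩
  rw [← Ideal.mem_span_singleton, ← Ideal.span_singleton_pow, ← Ideal.Quotient.eq]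
  exact Quotient.out_eq _

theorem exists_finite_cosets [Finite (R ⧸ Ideal.span {p})] {S L : Submodule R M} (hS : S.FG)
    {k : ℕ} (h : ∀ s ∈ S, p ^ k • s ∈ L) :
    ∃ F : Set M, F.Finite ∧ F ⊆ S ∧ ∀ s ∈ S, ∃ t ∈ F, t - s ∈ L := by
  obtain ⟨n, g, rfl⟩ := Submodule.fg_iff_exists_fin_generating_family.1 hS
  obtain ⟨E, hE, hE'⟩ := exists_finite_residues (p := p) k
  refine ⟨(fun c : Fin n → R => ∑ i, c i • g i) '' Set.pi Set.univ fun _ => E,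
    (Set.Finite.pi fun _ => hE).image _, ?_, fun s hs => ?_⟩
  · rintro _ ⟨c, -, rfl⟩
    exact (Submodule.mem_span_range_iff_exists_fun R).2 ⟨c, rfl⟩
  · obtain ⟨c, rfl⟩ := (Submodule.mem_span_range_iff_exists_fun R).1 hs
    choose f hf hfc using hE'
    refine ⟨_, ⟨fun i => f (c i), fun i _ => hf _, rfl⟩, ?_⟩
    rw [← Finset.sum_sub_distrib]
    refine sum_mem fun i _ => ?_
    obtain ⟨d, hd⟩ := hfc (c i)
    rw [← sub_smul, hd, mul_comm, mul_smul]
    exact L.smul_mem _ (h _ (Submodule.subset_span ⟨i, rfl⟩))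

end Hull

section HullDomain

variable {R : Type v} [CommRing R] [IsDomain R]
  {M : Type u} [AddCommGroup M] [Module R M] {p : R}

theorem subset_hull (L : Submodule R M) : (L : Set M) ⊆ hull L :=
  fun x hx => ⟨1, one_ne_zero, by rwa [one_smul]⟩

theorem add_mem_hull {L : Submodule R M} {x y : M} (hx : x ∈ hull L) (hy : y ∈ hull L) :
    x + y ∈ hull L := by
  obtain ⟨a, ha, h⟩ := hx
  obtain ⟨b, hb, h'⟩ := hy
  refine ⟨b * a, mul_ne_zero hb ha, ?_⟩
  rw [smul_add, mul_smul, mul_comm, mul_smul]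
  exact add_mem (L.smul_mem _ h) (L.smul_mem _ h')

theorem mem_hull_of_smul_mem_hull {L : Submodule R M} {x : M} {r : R} (hr : r ≠ 0)
    (hx : r • x ∈ hull L) : x ∈ hull L := by
  obtain ⟨a, ha, h⟩ := hx
  exact ⟨a * r, mul_ne_zero ha hr, by rwa [mul_smul]⟩

end HullDomain

section DVR

variable {R : Type v} [CommRing R] [IsDomain R] [IsDiscreteValuationRing R]
  {M : Type u} [AddCommGroup M] [Module R M] {p : R}

theorem mem_hull_iff (hp : Irreducible p) {L : Submodule R M} {x : M} :
    x ∈ hull L ↔ ∃ k : ℕ, p ^ k • x ∈ L := by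
  constructor
  · rintro ⟨a, ha, h⟩
    obtain ⟨n, hn⟩ := IsDiscreteValuationRing.associated_pow_irreducible ha hp
    obtain ⟨b, hb⟩ := hn.dvd
    exact ⟨n, by rw [hb, mul_comm, mul_smul]; exact L.smul_mem _ h⟩
  · rintro ⟨k, h⟩
    exact ⟨p ^ k, pow_ne_zero _ hp.ne_zero, h⟩

theorem exists_pow_smul_mem (hp : Irreducible p) {S L : Submodule R M} (hS : S.FG)
    (h : (S : Set M) ⊆ hull L) : ∃ k : ℕ, ∀ s ∈ S, p ^ k • s ∈ L := by
  obtain ⟨n, g, rfl⟩ := Submodule.fg_iff_exists_fin_generating_family.1 hS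
  have h1 : ∀ i, ∃ k : ℕ, p ^ k • g i ∈ L := fun i =>
    (mem_hull_iff hp).1 (h (Submodule.subset_span ⟨i, rfl⟩))
  choose k hk using h1
  refine ⟨Finset.univ.sup k, fun s hs => ?_⟩
  obtain ⟨c, rfl⟩ := (Submodule.mem_span_range_iff_exists_fun R).1 hs
  rw [Finset.smul_sum]
  refine sum_mem fun i _ => ?_
  rw [smul_comm]
  exact L.smul_mem _ (pow_smul_mem_of_le (hk i) (Finset.le_sup (Finset.mem_univ i)))

theorem pow_dvd_of_pheight_lt {d : R} {x : M} {n : ℕ}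
    (h : pheight p (p ^ n • x) < pheight p (d • x)) : p ^ n ∣ d :=
  (ValuationRing.dvd_total (p ^ n) d).resolve_right fun h' =>
    (pheight_smul_le_of_dvd h' x).not_gt h

/-- Changing `d` by an element of strictly larger valuation gives an associate. -/
theorem associated_sub_of_mul_dvd (hp : Irreducible p) {d e : R} (h : d * p ∣ e) :
    Associated (d - e) d := by
  obtain ⟨c, rfl⟩ := h
  have hu : IsUnit (1 - p * c) := by
    refine (IsLocalRing.isUnit_or_isUnit_of_add_one (a := p * c) (b := 1 - p * c)
      (by ring)).resolve_left fun hu => hp.not_isUnit (isUnit_of_mul_isUnit_left hu)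
  rw [show d - d * p * c = d * (1 - p * c) by ring]
  exact associated_mul_unit_left d _ hu

end DVR

section Nice

variable {R : Type v} [CommRing R] [IsDomain R] [IsDiscreteValuationRing R]
  {M : Type u} [AddCommGroup M] [Module R M] {p : R}

theorem IsDecompWrt.exists_separating_coset (hp : Irreducible p) {X : Set M} (hXf : X.Finite)
    {x : M} (hx : x ∉ X) (hX : IsDecompWrt p (insert x X)) (t : M) :
    ∃ N : ℕ, ∀ d : R, p ^ N ∣ d → ∀ u ∈ Submodule.span R X,
      pheight p (t + u + d • x) ≤ pheight p (d • x) := by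
  by_contra! hcon
  obtain ⟨d₀, -, u₀, hu₀, h₀⟩ := hcon 0
  have hd₀ : d₀ ≠ 0 := by
    rintro rfl
    simp at h₀
  obtain ⟨k, hk⟩ := IsDiscreteValuationRing.associated_pow_irreducible hd₀ hp
  obtain ⟨d, hd, u, hu, h⟩ := hcon (k + 1)
  have hdvd : d₀ * p ∣ d := ((hk.mul_right p).dvd.trans (pow_succ p k).symm.dvd).trans hd
  have h1 := hX.pheight_add_smul_le hXf hx (sub_mem hu₀ hu) (d₀ - d)
  rw [pheight_smul_of_associated (associated_sub_of_mul_dvd hp hdvd)] at h1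
  have h2 : pheight p (d₀ • x) ≤ pheight p (d • x) :=
    pheight_smul_le_of_dvd ((dvd_mul_right _ _).trans hdvd) x
  have h3 := lt_pheight_sub h₀ (h2.trans_lt h)
  rw [show t + u₀ + d₀ • x - (t + u + d • x) = u₀ - u + (d₀ - d) • x by
    rw [sub_smul]; abel] at h3
  exact h3.not_ge h1

theorem IsDecompWrt.exists_separating [Finite (R ⧸ Ideal.span {p})] (hp : Irreducible p)
    {X : Set M} (hXf : X.Finite) {x : M} (hx : x ∉ X) (hX : IsDecompWrt p (insert x X))
    {S : Submodule R M} (hS : S.FG) (hSX : (S : Set M) ⊆ hull (Submodule.span R X)) :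
    ∃ N : ℕ, ∀ d : R, p ^ N ∣ d → ∀ s ∈ S, pheight p (s + d • x) ≤ pheight p (d • x) := by
  obtain ⟨k, hk⟩ := exists_pow_smul_mem hp hS hSX
  obtain ⟨F, hF, -, hFS⟩ := exists_finite_cosets hS hk
  choose N hN using hX.exists_separating_coset hp hXf hx
  refine ⟨hF.toFinset.sup N, fun d hd s hs => ?_⟩
  obtain ⟨t, ht, hts⟩ := hFS s hs
  have h := hN t d ((pow_dvd_pow p (Finset.le_sup (hF.mem_toFinset.2 ht))).trans hd) (s - t)
    (by rw [← neg_sub]; exact neg_mem hts)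
  rwa [add_sub_cancel] at h

theorem IsDecompWrt.exists_finite_dominating [Finite (R ⧸ Ideal.span {p})] (hp : Irreducible p)
    {X : Set M} (hXf : X.Finite) (hX : IsDecompWrt p X) {a : M}
    (ha : a ∈ hull (Submodule.span R X)) :
    ∃ F : Set M, F.Finite ∧ F ⊆ Submodule.span R X ∧
      ∀ s ∈ Submodule.span R X, ∃ t ∈ F, pheight p (a + s) ≤ pheight p (a + t) := by
  classical
  have := hXf.fintype
  obtain ⟨k, hk⟩ := (mem_hull_iff hp).1 ha
  obtain ⟨b, hb⟩ := mem_span_iff_exists_sum.1 hk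
  let v : (X → R) → M := fun c => ∑ i, c i • (i : M)
  have hv : ∀ c, v c ∈ Submodule.span R X := fun c => mem_span_iff_exists_sum.2 ⟨c, rfl⟩
  have hvsub : ∀ c c', v c - v c' = v (fun i => c i - c' i) := fun c c' => by
    simp [v, sub_smul]
  -- coordinates along which the heights in the coset are not bounded by any `p ^ r • i`
  let Unb : X → Prop := fun i => ∀ r : ℕ, ∃ c, pheight p (p ^ r • (i : M)) < pheight p (a + v c)
  have hpk : ∀ c i, pheight p (a + v c) ≤ pheight p ((b i + p ^ k * c i) • (i : M)) := by
    intro c i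
    refine (pheight_le_smul (p ^ k) _).trans ?_
    have : p ^ k • (a + v c) = v (fun i => b i + p ^ k * c i) := by
      simp only [v, smul_add, ← hb, Finset.smul_sum, add_smul, mul_smul, Finset.sum_add_distrib]
    rw [this]
    exact hX.pheight_sum_le _ i
  have hdvd : ∀ c (i : X) r, pheight p (p ^ r • (i : M)) < pheight p (a + v c) →
      p ^ r ∣ b i + p ^ k * c i := fun c i r h => pow_dvd_of_pheight_lt (h.trans_le (hpk c i))
  have he : ∀ i, ∃ e : R, Unb i → b i = -(p ^ k * e) := by
    intro i
    by_cases hi : Unb i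
    · obtain ⟨c, hc⟩ := hi k
      obtain ⟨e, he⟩ := (dvd_add_left (dvd_mul_right (p ^ k) (c i))).1 (hdvd c i k hc)
      exact ⟨-e, fun _ => by rw [he]; ring⟩
    · exact ⟨0, fun h => absurd h hi⟩
  choose e he using he
  have hdvd' : ∀ c (i : X) r, Unb i → pheight p (p ^ (k + r) • (i : M)) < pheight p (a + v c) →
      p ^ r ∣ c i - e i := by
    intro c i r hi h
    have h1 := hdvd c i _ h
    rw [he i hi, pow_add, show -(p ^ k * e i) + p ^ k * c i = p ^ k * (c i - e i) by ring] at h1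
    exact (mul_dvd_mul_iff_left (pow_ne_zero _ hp.ne_zero)).1 h1
  have hunb : ∀ c i, Unb i → pheight p (a + v c) ≤ pheight p ((e i - c i) • (i : M)) := by
    intro c i hi
    by_cases hne : e i - c i = 0
    · simp [hne]
    obtain ⟨n, hn⟩ := IsDiscreteValuationRing.associated_pow_irreducible hne hp
    obtain ⟨c₂, hc₂⟩ := hi (k + (n + 1))
    have hn' : (e i - c i) * p ∣ p ^ (n + 1) := ((hn.mul_right p).dvd.trans (pow_succ p n).symm.dvd)
    have key : ∀ c', pheight p (p ^ (k + (n + 1)) • (i : M)) < pheight p (a + v c') →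
        Associated (c' i - c i) (e i - c i) := by
      intro c' h
      have h2 := hn'.trans (hdvd' c' i _ hi h)
      rw [← dvd_neg] at h2
      have h3 := associated_sub_of_mul_dvd hp h2
      rwa [show e i - c i - -(c' i - e i) = c' i - c i by ring] at h3
    rcases le_total (pheight p (a + v c)) (pheight p (a + v c₂)) with hle | hle
    · rw [← pheight_smul_of_associated (key c₂ hc₂)]
      have h4 := le_pheight_sub hle le_rfl
      rw [add_sub_add_left_eq_sub, hvsub] at h4
      exact h4.trans (hX.pheight_sum_le _ i)
    · have h5 := key c (hc₂.trans_le hle)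
      rw [sub_self] at h5
      exact absurd (h5.symm.eq_zero_iff.2 rfl) hne
  have hbd : ∀ i, ∃ r : ℕ, ¬ Unb i → ∀ c, pheight p (a + v c) ≤ pheight p (p ^ r • (i : M)) := by
    intro i
    by_cases hi : Unb i
    · exact ⟨0, fun h => absurd hi h⟩
    · simp only [Unb] at hi
      push Not at hi
      obtain ⟨r, hr⟩ := hi
      exact ⟨r, fun _ => hr⟩
  choose r hr using hbd
  choose E hE hE' using exists_finite_residues (p := p)
  let D : X → Set R := fun i => if Unb i then {e i} else E (r i)
  have hD : ∀ i, (D i).Finite := by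
    intro i
    simp only [D]
    split_ifs
    · exact Set.finite_singleton _
    · exact hE _
  refine ⟨v '' Set.pi Set.univ D, (Set.Finite.pi hD).image _, ?_, ?_⟩
  · rintro _ ⟨c, -, rfl⟩
    exact hv c
  · intro s hs
    obtain ⟨c, rfl⟩ := mem_span_iff_exists_sum.1 hs
    have hc' : ∀ i, ∃ d ∈ D i, pheight p (a + v c) ≤ pheight p ((d - c i) • (i : M)) := by
      intro i
      by_cases hi : Unb i
      · exact ⟨e i, by simp [D, hi], hunb c i hi⟩
      · obtain ⟨d, hd, hdc⟩ := hE' (r i) (c i)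
        exact ⟨d, by simpa [D, hi], (hr i hi c).trans (pheight_smul_le_of_dvd hdc _)⟩
    choose c' hc'D hc' using hc'
    refine ⟨v c', ⟨c', fun i _ => hc'D i, rfl⟩, ?_⟩
    have h := le_pheight_add (le_refl (pheight p (a + v c)))
      ((hX.le_pheight_sum_iff fun i => c' i - c i).2 hc')
    change _ ≤ pheight p (a + v c + v fun i => c' i - c i) at h
    rwa [← hvsub, add_assoc, add_sub_cancel] at h

theorem IsDecompWrt.exists_max_height [Finite (R ⧸ Ideal.span {p})] (hp : Irreducible p)
    {X : Set M} (hXf : X.Finite) (hX : IsDecompWrt p X) {a : M}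
    (ha : a ∈ hull (Submodule.span R X)) {S : Submodule R M} (hS : S.FG)
    (hXS : Submodule.span R X ≤ S) (hSX : (S : Set M) ⊆ hull (Submodule.span R X)) :
    ∃ s ∈ S, ∀ s' ∈ S, pheight p (a + s') ≤ pheight p (a + s) := by
  obtain ⟨k, hk⟩ := exists_pow_smul_mem hp hS hSX
  obtain ⟨F, hF, hFS, hF'⟩ := exists_finite_cosets hS hk
  choose! E hE hES hE' using fun t (ht : t ∈ F) =>
    hX.exists_finite_dominating hp hXf (add_mem_hull ha (hSX (hFS ht)))
  let D : Set M := ⋃ t ∈ F, (fun u => t + u) '' E t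
  have hD : D.Finite := hF.biUnion fun t ht => (hE t ht).image _
  have hdom : ∀ s ∈ S, ∃ d ∈ D, pheight p (a + s) ≤ pheight p (a + d) := by
    intro s hs
    obtain ⟨t, ht, hts⟩ := hF' s hs
    obtain ⟨u, hu, h⟩ := hE' t ht (s - t) (by rw [← neg_sub]; exact neg_mem hts)
    refine ⟨t + u, Set.mem_biUnion ht ⟨u, hu, rfl⟩, ?_⟩
    rwa [add_assoc, add_sub_cancel, add_assoc] at h
  obtain ⟨d₀, hd₀, -⟩ := hdom 0 S.zero_mem
  obtain ⟨d, hd, hmax⟩ := Set.exists_max_image D (fun d => pheight p (a + d)) hD ⟨d₀, hd₀⟩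
  refine ⟨d, ?_, fun s hs => ?_⟩
  · obtain ⟨t, ht, u, hu, rfl⟩ := Set.mem_iUnion₂.1 hd
    exact add_mem (hFS ht) (hXS (hES t ht hu))
  · obtain ⟨d', hd', h⟩ := hdom s hs
    exact h.trans (hmax d' hd')

end Nice

section PDB

variable {R : Type v} [CommRing R] {M : Type u} [AddCommGroup M] [Module R M] {p : R}

theorem IsPDBWrt.exists_superset {C : Set (Set M)} (hC : IsPDBWrt p C) {X : Set M} (hX : X ∈ C)
    {F : Set M} (hF : F.Finite) : ∃ Y ∈ C, X ⊆ Y ∧ F ⊆ hull (Submodule.span R Y) := by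
  induction F, hF using Set.Finite.induction_on with
  | empty => exact ⟨X, hX, subset_rfl, Set.empty_subset _⟩
  | @insert a F _ _ ih =>
    obtain ⟨Y, hY, hXY, hFY⟩ := ih
    obtain ⟨Z, hZ, hYZ, ha⟩ := hC.2.2.2 Y hY a
    exact ⟨Z, hZ, hXY.trans hYZ,
      Set.insert_subset ha (hFY.trans (hull_mono (Submodule.span_mono hYZ)))⟩

theorem coe_add_one_le_wHat_iff {C : Set (Set M)} {u : ℕ → WithTop Ordinal.{u}} {n : ℕ} :
    ((n + 1 : ℕ) : ℕ∞) ≤ wHat p C u ↔ ∃ X ∈ C, HasAtLeast p u (n + 1) X := by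
  constructor
  · intro h
    have h1 : (n : ℕ∞) < wHat p C u := lt_of_lt_of_le (by exact_mod_cast Nat.lt_succ_self n) h
    obtain ⟨_, ⟨m, rfl, X, hX, s, hs, hm, hsu⟩, hnm⟩ := lt_sSup_iff.1 h1
    refine ⟨X, hX, s, hs, ?_, hsu⟩
    have : n < m := by exact_mod_cast hnm
    omega
  · rintro ⟨X, hX, h⟩
    exact le_sSup ⟨n + 1, rfl, X, hX, h⟩

theorem exists_shift_ulmSeqOf_eq {u : ℕ → WithTop Ordinal.{u}} {s : Finset M}
    (hu : ∀ x ∈ s, UlmEquiv (UlmSeqOf p x) u) (k : ℕ) :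
    ∃ (K : s → ℕ) (N : ℕ), ∀ z, k ≤ K z ∧ ∀ i, UlmSeqOf p (p ^ K z • (z : M)) i = u (i + N) := by
  choose m n hmn using fun z : s => hu z z.2
  refine ⟨fun z => n z + (Finset.univ.sup m + k - m z), Finset.univ.sup m + k, fun z => ?_⟩
  have hm : m z ≤ Finset.univ.sup m := Finset.le_sup (Finset.mem_univ z)
  refine ⟨by dsimp only; omega, fun i => ?_⟩
  have h := hmn z (i + (Finset.univ.sup m + k - m z))
  rw [show i + (Finset.univ.sup m + k - m z) + m z = i + (Finset.univ.sup m + k) by omega] at h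
  rw [← h, UlmSeqOf, UlmSeqOf, smul_smul, ← pow_add]
  dsimp only
  congr 3
  omega

end PDB

section Invariance

variable {R : Type v} [CommRing R] [IsDomain R] [IsDiscreteValuationRing R]
  {M : Type u} [AddCommGroup M] [Module R M] {p : R}

theorem pheight_smul_eq_of_ulmSeqOf_eq {N : Type u} [AddCommGroup N] [Module R N]
    (hp : Irreducible p) {x : M} {y : N} (h : UlmSeqOf p x = UlmSeqOf p y) (r : R) :
    pheight p (r • x) = pheight p (r • y) := by
  rcases eq_or_ne r 0 with rfl | hr
  · simp
  · obtain ⟨n, hn⟩ := IsDiscreteValuationRing.associated_pow_irreducible hr hp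
    rw [pheight_smul_of_associated hn, pheight_smul_of_associated hn]
    exact congrFun h n

theorem exists_dvd_all {ι : Type*} [Finite ι] {c : ι → R} (hc : c ≠ 0) :
    ∃ j, c j ≠ 0 ∧ ∀ i, c j ∣ c i := by
  obtain ⟨i₀, hi₀⟩ := Function.ne_iff.1 hc
  have : Nonempty ι := ⟨i₀⟩
  obtain ⟨j, hj⟩ := Finite.exists_min fun i => IsDiscreteValuationRing.addVal R (c i)
  have hj' : ∀ i, c j ∣ c i := fun i => IsDiscreteValuationRing.addVal_le_iff_dvd.1 (hj i)
  exact ⟨j, fun h => hi₀ (zero_dvd_iff.1 (h ▸ hj' i₀)), hj'⟩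

theorem exists_dvd_of_sum_eq (hp : Irreducible p) {ι : Type*} {s : Finset ι} {f : ι → R} {π : R}
    (hπ : π ≠ 0) (h : ∑ i ∈ s, f i = π) : ∃ i ∈ s, f i ∣ π := by
  by_contra! hcon
  have h1 : ∀ i ∈ s, p * π ∣ f i := by
    intro i hi
    obtain ⟨q, hq⟩ := (ValuationRing.dvd_total π (f i)).resolve_right (hcon i hi)
    have hq' : ¬ IsUnit q := fun hu => hcon i hi (hq ▸ (associated_mul_unit_left π q hu).dvd)
    have hpq : p ∣ q := by
      rw [← Ideal.mem_span_singleton, ← hp.maximalIdeal_eq]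
      exact hq'
    rw [hq, mul_comm]
    exact mul_dvd_mul_left π hpq
  obtain ⟨q, hq⟩ := h ▸ Finset.dvd_sum h1
  have : p * q = 1 := mul_left_cancel₀ hπ (by rw [mul_one]; nth_rewrite 2 [hq]; ring)
  exact hp.not_isUnit (IsUnit.of_mul_eq_one _ this)

theorem exists_common_pow (hp : Irreducible p) {ι : Type*} [Fintype ι] {L : Submodule R M}
    {f : ι → M} (h : ∀ i, f i ∈ hull L) : ∃ k : ℕ, ∀ i, p ^ k • f i ∈ L := by
  choose k hk using fun i => (mem_hull_iff hp).1 (h i)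
  exact ⟨Finset.univ.sup k, fun i => pow_smul_mem_of_le (hk i) (Finset.le_sup (Finset.mem_univ i))⟩

/-- The number of elements with a given class of Ulm sequences cannot drop when passing from part
of a decomposition set to a decomposition set with the same hull. -/
theorem IsDecompWrt.hasAtLeast_of_hull (hp : Irreducible p) {Z Y : Set M} (hZf : Z.Finite)
    (hYf : Y.Finite) (hZ : IsDecompWrt p Z) (hY : IsDecompWrt p Y)
    (hYZ : Y ⊆ hull (Submodule.span R Z)) {s : Finset M} (hsZ : ↑s ⊆ Z)
    (hsY : ↑s ⊆ hull (Submodule.span R Y)) {u : ℕ → WithTop Ordinal.{u}}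
    (hu : ∀ x ∈ s, UlmEquiv (UlmSeqOf p x) u) : HasAtLeast p u s.card Y := by
  classical
  have := hZf.fintype
  have := hYf.fintype
  obtain ⟨k, hk⟩ := exists_common_pow hp (f := fun z : s => (z : M)) fun z => hsY z.2
  obtain ⟨K, N, hKN⟩ := exists_shift_ulmSeqOf_eq hu k
  have hU : ∀ (z j : s) (r : R),
      pheight p (r • p ^ K z • (z : M)) = pheight p (r • p ^ K j • (j : M)) := fun z j =>
    pheight_smul_eq_of_ulmSeqOf_eq hp (funext fun i => ((hKN z).2 i).trans ((hKN j).2 i).symm)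
  choose a ha using fun z : s => mem_span_iff_exists_sum.1 (pow_smul_mem_of_le (hk z) (hKN z).1)
  obtain ⟨r, hr⟩ := exists_common_pow hp (f := fun y : Y => (y : M)) fun y => hYZ y.2
  choose d hd using fun y : Y => mem_span_iff_exists_sum.1 (hr y)
  let t : Finset M := Y.toFinset.filter fun y => UlmEquiv (UlmSeqOf p y) u
  have htY : ∀ y ∈ t, y ∈ Y := fun y hy => by simpa using (Finset.mem_filter.1 hy).1
  refine ⟨t, htY, ?_, fun y hy => (Finset.mem_filter.1 hy).2⟩
  let A : Matrix t s R := fun y z => a z ⟨y, htY y y.2⟩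
  have hinj : Function.Injective A.mulVecLin := by
    rw [injective_iff_map_eq_zero]
    intro c hc
    by_contra hne
    obtain ⟨j, hj0, hj⟩ := exists_dvd_all hne
    let b : Y → R := fun y => ∑ z, a z y * c z
    have hb : ∀ y : Y, (y : M) ∈ t → b y = 0 := fun y hy => congrFun hc ⟨y, hy⟩
    let w : M := ∑ y, b y • (y : M)
    have hw : w = ∑ z, c z • p ^ K z • (z : M) := by
      simp only [w, b, ← ha, Finset.sum_smul, Finset.smul_sum, smul_smul]
      rw [Finset.sum_comm]
      simp only [mul_comm]
    let g : Z → R := fun z => if hz : (z : M) ∈ s then c ⟨z, hz⟩ * p ^ K ⟨z, hz⟩ else 0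
    have hg : ∑ z, g z • (z : M) = w := by
      rw [Finset.sum_set_coe Z
        (f := fun z => (if hz : z ∈ s then c ⟨z, hz⟩ * p ^ K ⟨z, hz⟩ else 0) • z),
        hw, ← Finset.sum_subset (s₁ := s) (fun z hz => by simpa using hsZ hz)
        (fun z _ hz => by simp [hz]), ← Finset.sum_coe_sort]
      exact Finset.sum_congr rfl fun z _ => by simp [smul_smul]
    have hd' : ∀ (y : Y) (q : R), q • p ^ r • (y : M) = ∑ z, (q * d y z) • (z : M) := by
      intro y q
      rw [← hd, Finset.smul_sum]
      simp only [smul_smul]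
    have hcoef : ∀ z, p ^ r * g z = ∑ y, b y * d y z := by
      have h1 : ∑ z, (p ^ r * g z - ∑ y, b y * d y z) • (z : M) = 0 := by
        simp only [sub_smul, Finset.sum_sub_distrib, mul_smul, ← Finset.smul_sum, hg]
        simp only [Finset.sum_smul]
        rw [Finset.sum_comm]
        simp only [← hd', w, Finset.smul_sum, sub_eq_zero]
        exact Finset.sum_congr rfl fun y _ => smul_comm _ _ _
      exact fun z => sub_eq_zero.1 (Fintype.linearIndependent_iff.1 hZ.1 _ h1 z)
    let j' : Z := ⟨j, hsZ j.2⟩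
    have hgj : g j' = c j * p ^ K j := by simp [g, j']
    let π : R := p ^ r * g j'
    have hπ : π ≠ 0 := by
      simp only [π, hgj]
      exact mul_ne_zero (pow_ne_zero _ hp.ne_zero) (mul_ne_zero hj0 (pow_ne_zero _ hp.ne_zero))
    obtain ⟨y, -, hy⟩ := exists_dvd_of_sum_eq hp hπ (hcoef j').symm
    have hby : b y ≠ 0 := by
      intro h0
      rw [h0, zero_mul, zero_dvd_iff] at hy
      exact hπ hy
    have hle : ∀ q : R, pheight p (q • (p ^ r * b y) • (y : M)) ≤ pheight p (q • π • (j : M)) := by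
      intro q
      rw [smul_smul, show q * (p ^ r * b y) = (q * b y) * p ^ r by ring, mul_smul, hd', smul_smul]
      exact (hZ.pheight_sum_le _ j').trans
        (pheight_smul_le_of_dvd (by rw [mul_assoc]; exact mul_dvd_mul_left q hy) _)
    have hge : ∀ q : R, pheight p (q • π • (j : M)) ≤ pheight p (q • (p ^ r * b y) • (y : M)) := by
      intro q
      have h1 : (q * p ^ r) • w = ∑ y, (q * (p ^ r * b y)) • (y : M) := by
        simp only [w, Finset.smul_sum, smul_smul, mul_assoc]
      have h2 : pheight p (q • π • (j : M)) ≤ pheight p ((q * p ^ r) • w) := by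
        rw [← hg, Finset.smul_sum]
        simp only [smul_smul]
        rw [hZ.le_pheight_sum_iff]
        intro z
        by_cases hz : (z : M) ∈ s
        · have hgz : g z = c ⟨z, hz⟩ * p ^ K ⟨z, hz⟩ := by simp [g, hz]
          rw [hgz, show q * π = (q * p ^ r * c j) * p ^ K j by simp only [π, hgj]; ring,
            ← mul_assoc, mul_smul, mul_smul (q * p ^ r * c ⟨z, hz⟩), hU j ⟨z, hz⟩]
          exact pheight_smul_le_of_dvd (mul_dvd_mul_left _ (hj _)) _
        · simp [g, hz]
      refine h2.trans ?_
      rw [h1, smul_smul]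
      exact hY.pheight_sum_le _ y
    obtain ⟨e, he⟩ := IsDiscreteValuationRing.associated_pow_irreducible
      (mul_ne_zero (pow_ne_zero r hp.ne_zero) hby) hp
    obtain ⟨f, hf⟩ := IsDiscreteValuationRing.associated_pow_irreducible hπ hp
    refine hby (hb y (Finset.mem_filter.2 ⟨by simp, UlmEquiv.trans ⟨f, e, fun i => ?_⟩ (hu j j.2)⟩))
    have h := le_antisymm (hle (p ^ i)) (hge (p ^ i))
    rw [smul_smul, smul_smul, pheight_smul_of_associated (he.mul_left _),
      pheight_smul_of_associated (hf.mul_left _)] at h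
    rwa [UlmSeqOf, UlmSeqOf, pow_add, pow_add]
  simpa using card_le_of_injective R A.mulVecLin hinj

theorem IsPDBWrt.exists_superset_hasAtLeast (hp : Irreducible p) {C : Set (Set M)}
    (hC : IsPDBWrt p C) {X Z : Set M} (hX : X ∈ C) (hZ : Z ∈ C) {u : ℕ → WithTop Ordinal.{u}}
    {n : ℕ} (h : HasAtLeast p u n Z) : ∃ Y ∈ C, X ⊆ Y ∧ HasAtLeast p u n Y := by
  obtain ⟨s, hsZ, hn, hs⟩ := h
  obtain ⟨Y, hY, hXY, hsY⟩ := hC.exists_superset hX s.finite_toSet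
  obtain ⟨W, hW, hZW, hYW⟩ := hC.exists_superset hZ (hC.2.1 Y hY)
  obtain ⟨t, htY, hst, ht⟩ := (hC.2.2.1 W hW).hasAtLeast_of_hull hp (hC.2.1 W hW) (hC.2.1 Y hY)
    (hC.2.2.1 Y hY) hYW (hsZ.trans hZW) hsY hs
  exact ⟨Y, hY, hXY, t, htY, hn.trans hst, ht⟩

end Invariance

section Count

variable {R : Type v} [CommRing R] [IsNoetherianRing R]

theorem exists_of_forall_exists_sub_mem {p : R} [Finite (R ⧸ Ideal.span {p})]
    {M N : Type u} [AddCommGroup M] [Module R M] [AddCommGroup N] [Module R N]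
    {Γ : Submodule R (M × N)} (hΓ : Γ.FG)
    {V P : Submodule R M} {W Q : Submodule R N}
    (hPQ : ∀ z ∈ Γ, z.1 ∈ P ↔ z.2 ∈ Q)
    (hVW : ∀ z ∈ Γ, (∃ v ∈ V, v - z.1 ∈ P) ↔ ∃ w ∈ W, w - z.2 ∈ Q)
    (hW : ∀ w ∈ W, p • w = 0)
    (hcard : Finite (W.map Q.mkQ) →
      Finite (V.map P.mkQ) ∧ Nat.card (V.map P.mkQ) = Nat.card (W.map Q.mkQ))
    (h : ∀ w ∈ W, ∃ z ∈ Γ, w - z.2 ∈ Q) : ∀ v ∈ V, ∃ z ∈ Γ, v - z.1 ∈ P := by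
  let φ : Γ →ₗ[R] M ⧸ P := P.mkQ ∘ₗ LinearMap.fst R M N ∘ₗ Γ.subtype
  let ψ : Γ →ₗ[R] N ⧸ Q := Q.mkQ ∘ₗ LinearMap.snd R M N ∘ₗ Γ.subtype
  have hφψ : LinearMap.ker φ = LinearMap.ker ψ := by
    ext z
    simpa [φ, ψ] using hPQ z z.2
  have hcomap : (V.map P.mkQ).comap φ = (W.map Q.mkQ).comap ψ := by
    ext z
    simpa [φ, ψ, Submodule.Quotient.eq] using hVW z z.2
  have hψ : W.map Q.mkQ ≤ LinearMap.range ψ := by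
    rintro _ ⟨w, hw, rfl⟩
    obtain ⟨z, hz, hwz⟩ := h w hw
    exact ⟨⟨z, hz⟩, ((Submodule.Quotient.eq _).2 hwz).symm⟩
  have hΓ' : (LinearMap.range ψ).FG := by
    rw [LinearMap.range_eq_map]
    exact ((Submodule.fg_top Γ).2 hΓ).map ψ
  have hfin : Finite (W.map Q.mkQ) := by
    obtain ⟨F, hF, -, hFW⟩ := exists_finite_cosets (p := p) (k := 1) (L := ⊥)
      (hΓ'.of_le hψ) (by
        rintro _ ⟨w, hw, rfl⟩
        rw [pow_one, ← map_smul, hW w hw, map_zero]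
        exact zero_mem _)
    refine (hF.subset fun y hy => ?_).to_subtype
    obtain ⟨t, ht, hty⟩ := hFW y hy
    rwa [← sub_eq_zero.1 ((Submodule.mem_bot R).1 hty)]
  obtain ⟨hfin', hcard⟩ := hcard hfin
  have hlift : ∀ y ∈ W.map Q.mkQ, ∃ z, ψ z = y := fun y hy => hψ hy
  choose! g hg using hlift
  have hgV : ∀ y ∈ W.map Q.mkQ, φ (g y) ∈ V.map P.mkQ := fun y hy => by
    rw [← Submodule.mem_comap, hcomap, Submodule.mem_comap, hg y hy]
    exact hy
  have hinj : Set.InjOn (fun y => φ (g y)) (W.map Q.mkQ : Set (N ⧸ Q)) := fun y hy y' hy' hyy' => by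
    have h1 : g y - g y' ∈ LinearMap.ker ψ := by
      rw [← hφψ, LinearMap.mem_ker, map_sub, sub_eq_zero]
      exact hyy'
    rwa [LinearMap.mem_ker, map_sub, sub_eq_zero, hg y hy, hg y' hy'] at h1
  have himage : (fun y => φ (g y)) '' (W.map Q.mkQ : Set (N ⧸ Q)) = V.map P.mkQ := by
    refine Set.eq_of_subset_of_ncard_le (Set.image_subset_iff.2 hgV) ?_ hfin'
    rw [hinj.ncard_image]
    exact hcard.le
  intro v hv
  obtain ⟨y, -, hy⟩ := himage.ge (Submodule.mem_map_of_mem (f := P.mkQ) hv)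
  exact ⟨g y, (g y).2, (Submodule.Quotient.eq P).1 hy.symm⟩

end Count

section Rank

variable {R : Type v} [CommRing R]

theorem finite_and_card_eq_of_min_rank_eq {p : R} [hm : (Ideal.span {p}).IsMaximal]
    [Finite (R ⧸ Ideal.span {p})]
    {M N : Type u} [AddCommGroup M] [Module R M] [AddCommGroup N] [Module R N]
    (hM : ∀ x : M, p • x = 0) (hN : ∀ x : N, p • x = 0)
    (h : min (Module.rank (R ⧸ Ideal.span {p}) (M ⧸ Ideal.span {p} • (⊤ : Submodule R M)))
        Cardinal.aleph0 =
      min (Module.rank (R ⧸ Ideal.span {p}) (N ⧸ Ideal.span {p} • (⊤ : Submodule R N)))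
        Cardinal.aleph0) [Finite N] : Finite M ∧ Nat.card M = Nat.card N := by
  let := Ideal.Quotient.field (Ideal.span {p})
  have hbot : ∀ {L : Type u} [AddCommGroup L] [Module R L], (∀ x : L, p • x = 0) →
      Ideal.span {p} • (⊤ : Submodule R L) = ⊥ := fun {L} _ _ hL => by
    rw [eq_bot_iff, Submodule.ideal_span_singleton_smul]
    rintro _ ⟨x, -, rfl⟩
    exact hL x
  have eM := Submodule.quotEquivOfEqBot _ (hbot hM)
  have eN := Submodule.quotEquivOfEqBot _ (hbot hN)
  have : Finite (N ⧸ Ideal.span {p} • (⊤ : Submodule R N)) := Finite.of_equiv _ eN.symm.toEquiv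
  have hlt : Module.rank (R ⧸ Ideal.span {p}) (N ⧸ Ideal.span {p} • (⊤ : Submodule R N)) <
      Cardinal.aleph0 := Module.rank_lt_aleph0 _ _
  rw [min_eq_left hlt.le] at h
  have hrank := (min_eq_iff.1 h).resolve_right fun h' => hlt.ne h'.1.symm
  obtain ⟨e⟩ := Module.nonempty_linearEquiv_iff_rank_eq.2 hrank.1
  have e' : M ≃ N := (eM.symm.toEquiv.trans e.toEquiv).trans eN.toEquiv
  exact ⟨Finite.of_equiv _ e'.symm, Nat.card_congr e'⟩

theorem finite_and_card_eq_of_uHat_eq {p : R} [(Ideal.span {p}).IsMaximal]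
    [Finite (R ⧸ Ideal.span {p})]
    {M N : Type u} [AddCommGroup M] [Module R M] [AddCommGroup N] [Module R N]
    {α : Ordinal.{u}} (h : uHat p M α = uHat p N α)
    (hfin : Finite ((ppow p α ⊓ Submodule.torsionBy R N p).map (ppow (M := N) p (α + 1)).mkQ)) :
    Finite ((ppow p α ⊓ Submodule.torsionBy R M p).map (ppow (M := M) p (α + 1)).mkQ) ∧
      Nat.card ((ppow p α ⊓ Submodule.torsionBy R M p).map (ppow (M := M) p (α + 1)).mkQ) =
      Nat.card ((ppow p α ⊓ Submodule.torsionBy R N p).map (ppow (M := N) p (α + 1)).mkQ) := by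
  have key : ∀ (L : Type u) [AddCommGroup L] [Module R L],
      Nonempty ((↥(ppow p α ⊓ Submodule.torsionBy R L p) ⧸
        (ppow p (α + 1) ⊓ Submodule.torsionBy R L p).comap
          (ppow p α ⊓ Submodule.torsionBy R L p).subtype) ≃
        (ppow p α ⊓ Submodule.torsionBy R L p).map (ppow (M := L) p (α + 1)).mkQ) := by
    intro L _ _
    let V : Submodule R L := ppow p α ⊓ Submodule.torsionBy R L p
    let φ := (ppow (M := L) p (α + 1)).mkQ ∘ₗ V.subtype
    have h1 : (ppow p (α + 1) ⊓ Submodule.torsionBy R L p).comap V.subtype = LinearMap.ker φ := by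
      ext x
      have hx : (x : L) ∈ Submodule.torsionBy R L p := x.2.2
      simp [φ, hx, -Submodule.mem_torsionBy_iff]
    have h2 : LinearMap.range φ = V.map (ppow (M := L) p (α + 1)).mkQ := by
      rw [LinearMap.range_comp, Submodule.range_subtype]
    rw [h1]
    exact ⟨(φ.quotKerEquivRange.trans (LinearEquiv.ofEq _ _ h2)).toEquiv⟩
  obtain ⟨eM⟩ := key M
  obtain ⟨eN⟩ := key N
  have hkill : ∀ (L : Type u) [AddCommGroup L] [Module R L]
      (x : ↥(ppow p α ⊓ Submodule.torsionBy R L p) ⧸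
        (ppow p (α + 1) ⊓ Submodule.torsionBy R L p).comap
          (ppow p α ⊓ Submodule.torsionBy R L p).subtype), p • x = 0 := by
    intro L _ _ x
    obtain ⟨⟨y, hy⟩, rfl⟩ := Submodule.Quotient.mk_surjective _ x
    rw [← Submodule.Quotient.mk_smul]
    have : p • (⟨y, hy⟩ : ↥(ppow p α ⊓ Submodule.torsionBy R L p)) = 0 := Subtype.ext hy.2
    rw [this, Submodule.Quotient.mk_zero]
  have := Finite.of_equiv _ eN.symm
  obtain ⟨hf, hc⟩ := finite_and_card_eq_of_min_rank_eq (hkill M) (hkill N) h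
  exact ⟨Finite.of_equiv _ eM, by rw [← Nat.card_congr eM, ← Nat.card_congr eN, hc]⟩

theorem finite_and_card_eq_of_uHatInf_eq {p : R} [(Ideal.span {p}).IsMaximal]
    [Finite (R ⧸ Ideal.span {p})]
    {M N : Type u} [AddCommGroup M] [Module R M] [AddCommGroup N] [Module R N]
    (h : uHatInf p M = uHatInf p N)
    (hfin : Finite (((⨅ α : Ordinal.{u}, ppow p α) ⊓ Submodule.torsionBy R N p).map
      (⊥ : Submodule R N).mkQ)) :
    Finite (((⨅ α : Ordinal.{u}, ppow p α) ⊓ Submodule.torsionBy R M p).map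
      (⊥ : Submodule R M).mkQ) ∧
    Nat.card (((⨅ α : Ordinal.{u}, ppow p α) ⊓ Submodule.torsionBy R M p).map
      (⊥ : Submodule R M).mkQ) =
    Nat.card (((⨅ α : Ordinal.{u}, ppow p α) ⊓ Submodule.torsionBy R N p).map
      (⊥ : Submodule R N).mkQ) := by
  have key : ∀ {L : Type u} [AddCommGroup L] [Module R L] (V : Submodule R L),
      Nonempty (V ≃ V.map (⊥ : Submodule R L).mkQ) := fun {L} _ _ V =>
    ⟨(Submodule.equivMapOfInjective _ (LinearMap.ker_eq_bot.1 (Submodule.ker_mkQ _)) V).toEquiv⟩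
  obtain ⟨eM⟩ := key ((⨅ α : Ordinal.{u}, ppow p α) ⊓ Submodule.torsionBy R M p)
  obtain ⟨eN⟩ := key ((⨅ α : Ordinal.{u}, ppow p α) ⊓ Submodule.torsionBy R N p)
  have := Finite.of_equiv _ eN.symm
  obtain ⟨hf, hc⟩ := finite_and_card_eq_of_min_rank_eq (fun x => Subtype.ext x.2.2)
    (fun x => Subtype.ext x.2.2) h
  exact ⟨Finite.of_equiv _ eM, by rw [← Nat.card_congr eM, ← Nat.card_congr eN, hc]⟩

end Rank

section HeightIso

variable {R : Type v} [CommRing R] {M N : Type u} [AddCommGroup M] [Module R M]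
  [AddCommGroup N] [Module R N] {p : R}

theorem mem_iInf_ppow_iff {x : M} : x ∈ (⨅ α : Ordinal.{u}, ppow p α) ↔ pheight p x = ⊤ := by
  rw [← top_le_iff, le_pheight_iff, Submodule.mem_iInf]
  exact ⟨fun h α _ => h α, fun h α => h α le_top⟩

theorem exists_torsion_sub_mem_ppow_iff {L : Type u} [AddCommGroup L] [Module R L] {s : L}
    {α : Ordinal.{u}} :
    (∃ v ∈ ppow p α ⊓ Submodule.torsionBy R L p, v - s ∈ ppow p (α + 1)) ↔
      s ∈ ppow p α ∧ p • s ∈ ppow p (α + 1 + 1) := by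
  constructor
  · rintro ⟨v, ⟨hv, hpv⟩, hvs⟩
    have h := sub_mem hv (ppow_add_one_le α hvs)
    rw [sub_sub_cancel] at h
    refine ⟨h, mem_ppow_add_one.2 ⟨-(v - s), neg_mem hvs, ?_⟩⟩
    rw [neg_sub, smul_sub, (Submodule.mem_torsionBy_iff p v).1 hpv, sub_zero]
  · rintro ⟨hs, hps⟩
    obtain ⟨g, hg, hgs⟩ := mem_ppow_add_one.1 hps
    refine ⟨s - g, ⟨sub_mem hs (ppow_add_one_le α hg), ?_⟩, ?_⟩
    · exact (Submodule.mem_torsionBy_iff p _).2 (by rw [smul_sub, hgs, sub_self])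
    · rw [sub_sub_cancel_left]
      exact neg_mem hg

/-- The submodule `Γ` of `M × N` is the graph of a height-preserving isomorphism between finitely
generated submodules of `M` and `N`. -/
structure IsHeightIso (p : R) (Γ : Submodule R (M × N)) : Prop where
  fg : Γ.FG
  pheight_eq : ∀ z ∈ Γ, pheight p z.1 = pheight p z.2
  eq_zero_iff : ∀ z ∈ Γ, z.1 = 0 ↔ z.2 = 0

namespace IsHeightIso

variable {Γ : Submodule R (M × N)}

theorem swap (hΓ : IsHeightIso p Γ) :
    IsHeightIso p (Γ.map (LinearEquiv.prodComm R M N).toLinearMap) where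
  fg := hΓ.fg.map _
  pheight_eq := by
    rintro _ ⟨z, hz, rfl⟩
    exact (hΓ.pheight_eq z hz).symm
  eq_zero_iff := by
    rintro _ ⟨z, hz, rfl⟩
    exact (hΓ.eq_zero_iff z hz).symm

theorem mem_ppow_iff (hΓ : IsHeightIso p Γ) {z : M × N} (hz : z ∈ Γ) (α : Ordinal.{u}) :
    z.1 ∈ ppow p α ↔ z.2 ∈ ppow p α := by
  rw [← coe_le_pheight, ← coe_le_pheight, hΓ.pheight_eq z hz]

theorem sup_span (hΓ : IsHeightIso p Γ) {a : M} {b : N}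
    (h : ∀ z ∈ Γ, ∀ r : R, pheight p (z.1 + r • a) = pheight p (z.2 + r • b))
    (h0 : ∀ z ∈ Γ, ∀ r : R, z.1 + r • a = 0 ↔ z.2 + r • b = 0) :
    IsHeightIso p (Γ ⊔ Submodule.span R {(a, b)}) where
  fg := hΓ.fg.sup (Submodule.fg_span_singleton _)
  pheight_eq x hx := by
    obtain ⟨z, hz, y, hy, rfl⟩ := Submodule.mem_sup.1 hx
    obtain ⟨r, rfl⟩ := Submodule.mem_span_singleton.1 hy
    exact h z hz r
  eq_zero_iff x hx := by
    obtain ⟨z, hz, y, hy, rfl⟩ := Submodule.mem_sup.1 hx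
    obtain ⟨r, rfl⟩ := Submodule.mem_span_singleton.1 hy
    exact h0 z hz r

theorem exists_partner_of_forall_smul_le (hΓ : IsHeightIso p Γ) {a : M} {h : N} {α : Ordinal.{u}}
    (hah : (p • a, h) ∈ Γ) (haα : a ∈ ppow p α)
    (ha : ∀ z ∈ Γ, a + z.1 ∈ ppow p α → p • (a + z.1) ∉ ppow p (α + 1 + 1)) :
    ∃ b : N, p • b = h ∧ b ∈ ppow p α ∧ ∀ z ∈ Γ, b + z.2 ∉ ppow p (α + 1) := by
  obtain ⟨b, hb, rfl⟩ := mem_ppow_add_one.1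
    ((hΓ.mem_ppow_iff hah (α + 1)).1 (mem_ppow_add_one.2 ⟨a, haα, rfl⟩))
  refine ⟨b, rfl, hb, fun z hz hbz => ?_⟩
  have hz2 := sub_mem (ppow_add_one_le α hbz) hb
  rw [add_sub_cancel_left] at hz2
  refine ha z hz (add_mem haα ((hΓ.mem_ppow_iff hz α).2 hz2)) ?_
  have := (hΓ.mem_ppow_iff (add_mem hah (Γ.smul_mem p hz)) (α + 1 + 1)).2
    (mem_ppow_add_one.2 ⟨_, hbz, smul_add _ _ _⟩)
  rwa [smul_add]

variable [IsNoetherianRing R] [Finite (R ⧸ Ideal.span {p})] [(Ideal.span {p}).IsMaximal]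

theorem exists_torsion_of_uHat_eq (hΓ : IsHeightIso p Γ) {α : Ordinal.{u}}
    (hu : uHat p M α = uHat p N α) {v : M} (hv : v ∈ ppow p α) (hpv : p • v = 0)
    (h : ∀ z ∈ Γ, v - z.1 ∉ ppow p (α + 1)) :
    ∃ w : N, w ∈ ppow p α ∧ p • w = 0 ∧ ∀ z ∈ Γ, w - z.2 ∉ ppow p (α + 1) := by
  by_contra! hcon
  obtain ⟨z, hz, hvz⟩ := exists_of_forall_exists_sub_mem (p := p) hΓ.fg
    (V := ppow p α ⊓ Submodule.torsionBy R M p) (W := ppow p α ⊓ Submodule.torsionBy R N p)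
    (fun z hz => hΓ.mem_ppow_iff hz (α + 1))
    (fun z hz => by
      rw [exists_torsion_sub_mem_ppow_iff, exists_torsion_sub_mem_ppow_iff, hΓ.mem_ppow_iff hz]
      exact and_congr_right fun _ => hΓ.mem_ppow_iff (Γ.smul_mem p hz) _)
    (fun w hw => hw.2) (finite_and_card_eq_of_uHat_eq hu) (fun w hw => hcon w hw.1 hw.2)
    v ⟨hv, hpv⟩
  exact h z hz hvz

theorem exists_torsion_of_uHatInf_eq (hΓ : IsHeightIso p Γ)
    (hu : uHatInf p M = uHatInf p N) {v : M} (hv : pheight p v = ⊤) (hpv : p • v = 0)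
    (h : ∀ z ∈ Γ, z.1 ≠ v) :
    ∃ w : N, pheight p w = ⊤ ∧ p • w = 0 ∧ ∀ z ∈ Γ, z.2 ≠ w := by
  by_contra! hcon
  obtain ⟨z, hz, hvz⟩ := exists_of_forall_exists_sub_mem (p := p) hΓ.fg
    (V := (⨅ α : Ordinal.{u}, ppow p α) ⊓ Submodule.torsionBy R M p)
    (W := (⨅ α : Ordinal.{u}, ppow p α) ⊓ Submodule.torsionBy R N p) (P := ⊥) (Q := ⊥)
    hΓ.eq_zero_iff
    (fun z hz => by
      simp only [Submodule.mem_bot, sub_eq_zero, exists_eq_right, Submodule.mem_inf,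
        mem_iInf_ppow_iff, Submodule.mem_torsionBy_iff, hΓ.pheight_eq z hz]
      exact and_congr_right fun _ => hΓ.eq_zero_iff _ (Γ.smul_mem p hz))
    (fun w hw => hw.2) (finite_and_card_eq_of_uHatInf_eq hu)
    (fun w hw => by
      obtain ⟨z, hz, rfl⟩ := hcon w (mem_iInf_ppow_iff.1 hw.1) hw.2
      exact ⟨z, hz, by simp⟩)
    v ⟨mem_iInf_ppow_iff.2 hv, hpv⟩
  exact h z hz (sub_eq_zero.1 ((Submodule.mem_bot R).1 hvz)).symm

theorem exists_partner_top (hΓ : IsHeightIso p Γ) (hu : uHatInf p M = uHatInf p N) {a : M} {h : N}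
    (hah : (p • a, h) ∈ Γ) (ha : ∀ z ∈ Γ, z.1 ≠ a) (hat : pheight p a = ⊤) :
    ∃ b : N, p • b = h ∧ pheight p b = ⊤ ∧ ∀ z ∈ Γ, z.2 ≠ b := by
  have hht : pheight p h = ⊤ := by
    rw [← hΓ.pheight_eq _ hah]
    exact top_le_iff.1 (hat ▸ pheight_le_smul p a)
  obtain ⟨b, hb, rfl⟩ := exists_pheight_eq_top hht
  by_cases hbΓ : ∀ z ∈ Γ, z.2 ≠ b
  · exact ⟨b, rfl, hb, hbΓ⟩
  push Not at hbΓ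
  obtain ⟨⟨s, t⟩, hst, rfl⟩ := hbΓ
  have hs : pheight p s = ⊤ := (hΓ.pheight_eq _ hst).trans hb
  obtain ⟨w, hw, hpw, hwΓ⟩ := hΓ.exists_torsion_of_uHatInf_eq hu (v := a - s)
    (top_le_iff.1 (le_pheight_sub hat.ge hs.ge))
    (by
      rw [smul_sub]
      exact (hΓ.eq_zero_iff _ (sub_mem hah (Γ.smul_mem p hst))).2 (sub_self _))
    (fun z hz h => ha _ (add_mem hz hst) (by rw [Prod.fst_add, h, sub_add_cancel]))
  refine ⟨t + w, by rw [smul_add, hpw, add_zero], top_le_iff.1 (le_pheight_add hb.ge hw.ge), ?_⟩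
  exact fun z hz h => hwΓ _ (sub_mem hz hst) (by rw [Prod.snd_sub, h, add_sub_cancel_left])

theorem exists_partner_of_smul_mem (hΓ : IsHeightIso p Γ) {a : M} {h : N} {α : Ordinal.{u}}
    (hu : uHat p M α = uHat p N α) (hah : (p • a, h) ∈ Γ) (haα : a ∈ ppow p α)
    (hpa : p • a ∈ ppow p (α + 1 + 1)) (ha : ∀ z ∈ Γ, a + z.1 ∉ ppow p (α + 1)) :
    ∃ b : N, p • b = h ∧ b ∈ ppow p α ∧ ∀ z ∈ Γ, b + z.2 ∉ ppow p (α + 1) := by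
  obtain ⟨b, hb, hbh⟩ := mem_ppow_add_one.1 ((hΓ.mem_ppow_iff hah _).1 hpa)
  obtain ⟨g, hg, hga⟩ := mem_ppow_add_one.1 hpa
  obtain ⟨w, hw, hpw, hwΓ⟩ := hΓ.exists_torsion_of_uHat_eq hu (v := a - g)
    (sub_mem haα (ppow_add_one_le α hg)) (by rw [smul_sub, hga, sub_self])
    (fun z hz h => ha (-z) (neg_mem hz) (by
      have := add_mem h hg
      rwa [sub_right_comm, sub_add_cancel, sub_eq_add_neg] at this))
  refine ⟨w + b, by rw [smul_add, hpw, zero_add, hbh], add_mem hw (ppow_add_one_le α hb),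
    fun z hz h => hwΓ (-z) (neg_mem hz) ?_⟩
  have := sub_mem h hb
  rwa [add_right_comm, add_sub_cancel_right, ← sub_neg_eq_add] at this

end IsHeightIso

end HeightIso

section Extension

variable {R : Type v} [CommRing R] {M N : Type u} [AddCommGroup M] [Module R M]
  [AddCommGroup N] [Module R N] {p : R}

theorem isUnit_or_dvd_of_irreducible [IsDomain R] [IsDiscreteValuationRing R]
    (hp : Irreducible p) (r : R) : IsUnit r ∨ p ∣ r := by
  rcases eq_or_ne r 0 with rfl | hr
  · exact Or.inr (dvd_zero p)
  · obtain ⟨n, hn⟩ := IsDiscreteValuationRing.associated_pow_irreducible hr hp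
    rcases n with - | n
    · exact Or.inl (associated_one_iff_isUnit.1 (by simpa using hn))
    · exact Or.inr ((dvd_pow_self p n.succ_ne_zero).trans hn.symm.dvd)

theorem IsHeightIso.sup_span_of_smul_mem [IsDomain R] [IsDiscreteValuationRing R]
    {Γ : Submodule R (M × N)} (hp : Irreducible p)
    (hΓ : IsHeightIso p Γ) {a : M} {b : N} (hab : (p • a, p • b) ∈ Γ)
    (h : ∀ z ∈ Γ, pheight p (z.1 + a) = pheight p (z.2 + b))
    (ha : ∀ z ∈ Γ, z.1 ≠ a) (hb : ∀ z ∈ Γ, z.2 ≠ b) :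
    IsHeightIso p (Γ ⊔ Submodule.span R {(a, b)}) := by
  have hunit : ∀ {L : Type u} [AddCommGroup L] [Module R L] (r : Rˣ) (x y : L),
      x + (r : R) • y = (r : R) • (((r⁻¹ : Rˣ) : R) • x + y) := fun r x y => by
    rw [smul_add, smul_smul, Units.mul_inv, one_smul]
  refine hΓ.sup_span (fun z hz r => ?_) fun z hz r => ?_
  · rcases isUnit_or_dvd_of_irreducible hp r with ⟨r, rfl⟩ | ⟨r, rfl⟩
    · rw [hunit, hunit, pheight_smul_of_isUnit r.isUnit, pheight_smul_of_isUnit r.isUnit]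
      exact h _ (Γ.smul_mem ((r⁻¹ : Rˣ) : R) hz)
    · have := hΓ.pheight_eq _ (add_mem hz (Γ.smul_mem r hab))
      simpa only [mul_comm p r, mul_smul, Prod.fst_add, Prod.snd_add, Prod.smul_mk] using this
  · rcases isUnit_or_dvd_of_irreducible hp r with ⟨r, rfl⟩ | ⟨r, rfl⟩
    · have hz' := Γ.neg_mem (Γ.smul_mem ((r⁻¹ : Rˣ) : R) hz)
      rw [hunit, hunit, r.isUnit.smul_eq_zero, r.isUnit.smul_eq_zero]
      exact iff_of_false (fun h0 => ha _ hz' (neg_eq_of_add_eq_zero_right h0))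
        fun h0 => hb _ hz' (neg_eq_of_add_eq_zero_right h0)
    · have := hΓ.eq_zero_iff _ (add_mem hz (Γ.smul_mem r hab))
      simpa only [mul_comm p r, mul_smul, Prod.fst_add, Prod.snd_add, Prod.smul_mk] using this

/-- `Γ` is the graph of a height-preserving isomorphism between finitely generated submodules
which matches `X ∈ C` with `Y ∈ C'` and whose domain and range lie in the hulls of `X` and `Y`. -/
structure IsAdapted (p : R) (C : Set (Set M)) (C' : Set (Set N)) (Γ : Submodule R (M × N))
    (X : Set M) (Y : Set N) : Prop extends IsHeightIso p Γ where
  left_mem : X ∈ C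
  right_mem : Y ∈ C'
  fst_mem_hull : ∀ z ∈ Γ, z.1 ∈ hull (Submodule.span R X)
  snd_mem_hull : ∀ z ∈ Γ, z.2 ∈ hull (Submodule.span R Y)
  exists_right : ∀ x ∈ X, ∃ y ∈ Y, (x, y) ∈ Γ
  exists_left : ∀ y ∈ Y, ∃ x ∈ X, (x, y) ∈ Γ

namespace IsAdapted

variable {C : Set (Set M)} {C' : Set (Set N)} {Γ : Submodule R (M × N)} {X : Set M} {Y : Set N}

theorem swap (hΓ : IsAdapted p C C' Γ X Y) :
    IsAdapted p C' C (Γ.map (LinearEquiv.prodComm R M N).toLinearMap) Y X where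
  toIsHeightIso := hΓ.toIsHeightIso.swap
  left_mem := hΓ.right_mem
  right_mem := hΓ.left_mem
  fst_mem_hull := by
    rintro _ ⟨z, hz, rfl⟩
    exact hΓ.snd_mem_hull z hz
  snd_mem_hull := by
    rintro _ ⟨z, hz, rfl⟩
    exact hΓ.fst_mem_hull z hz
  exists_right y hy := by
    obtain ⟨x, hx, hxy⟩ := hΓ.exists_left y hy
    exact ⟨x, hx, _, hxy, rfl⟩
  exists_left x hx := by
    obtain ⟨y, hy, hxy⟩ := hΓ.exists_right x hx
    exact ⟨y, hy, _, hxy, rfl⟩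

variable [IsDomain R]

theorem sup_span (hΓ : IsAdapted p C C' Γ X Y) {a : M} {b : N}
    (h : IsHeightIso p (Γ ⊔ Submodule.span R {(a, b)})) {X' : Set M} {Y' : Set N}
    (hX'C : X' ∈ C) (hY'C : Y' ∈ C') (hXX' : X ⊆ X') (hYY' : Y ⊆ Y')
    (ha : a ∈ hull (Submodule.span R X')) (hb : b ∈ hull (Submodule.span R Y'))
    (hX' : ∀ x ∈ X', x ∈ X ∨ x = a ∧ b ∈ Y') (hY' : ∀ y ∈ Y', y ∈ Y ∨ y = b ∧ a ∈ X') :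
    IsAdapted p C C' (Γ ⊔ Submodule.span R {(a, b)}) X' Y' where
  toIsHeightIso := h
  left_mem := hX'C
  right_mem := hY'C
  fst_mem_hull x hx := by
    obtain ⟨z, hz, y, hy, rfl⟩ := Submodule.mem_sup.1 hx
    obtain ⟨r, rfl⟩ := Submodule.mem_span_singleton.1 hy
    exact add_mem_hull (hull_mono (Submodule.span_mono hXX') (hΓ.fst_mem_hull z hz))
      (smul_mem_hull r ha)
  snd_mem_hull x hx := by
    obtain ⟨z, hz, y, hy, rfl⟩ := Submodule.mem_sup.1 hx
    obtain ⟨r, rfl⟩ := Submodule.mem_span_singleton.1 hy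
    exact add_mem_hull (hull_mono (Submodule.span_mono hYY') (hΓ.snd_mem_hull z hz))
      (smul_mem_hull r hb)
  exists_right x hx := by
    rcases hX' x hx with hx | ⟨rfl, hb⟩
    · obtain ⟨y, hy, hxy⟩ := hΓ.exists_right x hx
      exact ⟨y, hYY' hy, Submodule.mem_sup_left hxy⟩
    · exact ⟨b, hb, Submodule.mem_sup_right (Submodule.mem_span_singleton_self _)⟩
  exists_left y hy := by
    rcases hY' y hy with hy | ⟨rfl, ha⟩
    · obtain ⟨x, hx, hxy⟩ := hΓ.exists_left y hy
      exact ⟨x, hXX' hx, Submodule.mem_sup_left hxy⟩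
    · exact ⟨a, ha, Submodule.mem_sup_right (Submodule.mem_span_singleton_self _)⟩

variable [IsDiscreteValuationRing R] [Finite (R ⧸ Ideal.span {p})]

theorem exists_partner (hp : Irreducible p) (hΓ : IsAdapted p C C' Γ X Y) (hC : IsPDBWrt p C)
    (hu : ∀ α : Ordinal.{u}, uHat p M α = uHat p N α) (huInf : uHatInf p M = uHatInf p N)
    {a : M} {h : N} (hah : (p • a, h) ∈ Γ) (ha : ∀ z ∈ Γ, z.1 ≠ a) :
    ∃ z₀ ∈ Γ, ∃ b : N, (p • (a + z₀.1), p • b) ∈ Γ ∧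
      (∀ z ∈ Γ, pheight p (z.1 + (a + z₀.1)) = pheight p (z.2 + b)) ∧ ∀ z ∈ Γ, z.2 ≠ b := by
  have hmax := PrincipalIdealRing.isMaximal_of_irreducible hp
  have haX := mem_hull_of_smul_mem_hull hp.ne_zero (hΓ.fst_mem_hull _ hah)
  obtain ⟨_, ⟨⟨s, t⟩, hst, rfl⟩, hs⟩ :=
    (hC.2.2.1 X hΓ.left_mem).exists_max_height hp (hC.2.1 X hΓ.left_mem) haX
      (hΓ.fg.map (LinearMap.fst R M N))
      (Submodule.span_le.2 fun x hx => by
        obtain ⟨y, -, hxy⟩ := hΓ.exists_right x hx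
        exact ⟨_, hxy, rfl⟩)
      (by
        rintro _ ⟨z, hz, rfl⟩
        exact hΓ.fst_mem_hull z hz)
  replace hs : ∀ z ∈ Γ, pheight p (a + z.1) ≤ pheight p (a + s) :=
    fun z hz => hs _ ⟨z, hz, rfl⟩
  rcases eq_or_ne (pheight p (a + s)) ⊤ with htop | hne
  · obtain ⟨b, hb, hbt, hbΓ⟩ := hΓ.exists_partner_top huInf (a := a + s) (h := h + p • t)
      (by rw [smul_add]; exact add_mem hah (Γ.smul_mem p hst))
      (fun z hz h => ha _ (sub_mem hz hst) (by rw [Prod.fst_sub, h, add_sub_cancel_right])) htop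
    refine ⟨(s, t), hst, b, ?_, fun z hz => ?_, hbΓ⟩
    · rw [hb, smul_add]
      exact add_mem hah (Γ.smul_mem p hst)
    · rw [add_comm, pheight_add_eq_min (by rw [htop]; exact le_top), htop, add_comm,
        pheight_add_eq_min (by rw [hbt]; exact le_top), hbt, hΓ.pheight_eq z hz]
  obtain ⟨α, hα⟩ := WithTop.ne_top_iff_exists.1 hne
  have hsα : ∀ z ∈ Γ, a + z.1 ∉ ppow p (α + 1) := fun z hz h =>
    (hα ▸ hs z hz).not_gt (coe_lt_pheight.2 h)
  have key : ∃ z₀ ∈ Γ, ∃ b : N, (p • (a + z₀.1), p • b) ∈ Γ ∧ a + z₀.1 ∈ ppow p α ∧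
      b ∈ ppow p α ∧ ∀ z ∈ Γ, b + z.2 ∉ ppow p (α + 1) := by
    by_cases hcase : ∃ z ∈ Γ, a + z.1 ∈ ppow p α ∧ p • (a + z.1) ∈ ppow p (α + 1 + 1)
    · obtain ⟨z₀, hz₀, hzα, hz₀'⟩ := hcase
      have hz : (p • (a + z₀.1), h + p • z₀.2) ∈ Γ := by
        rw [smul_add]; exact add_mem hah (Γ.smul_mem p hz₀)
      obtain ⟨b, hb, hbα, hbΓ⟩ := hΓ.exists_partner_of_smul_mem (hu α) hz hzα hz₀'
        fun z hz => by rw [add_assoc]; exact hsα _ (add_mem hz₀ hz)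
      exact ⟨z₀, hz₀, b, hb ▸ hz, hzα, hbα, hbΓ⟩
    · push Not at hcase
      have haα : a + s ∈ ppow p α := coe_le_pheight.1 hα.le
      have hz : (p • (a + s), h + p • t) ∈ Γ := by
        rw [smul_add]; exact add_mem hah (Γ.smul_mem p hst)
      obtain ⟨b, hb, hbα, hbΓ⟩ := hΓ.exists_partner_of_forall_smul_le hz haα
        fun z hz hz' => by
          rw [add_assoc a s] at hz' ⊢
          exact hcase _ (add_mem hst hz) hz'
      exact ⟨_, hst, b, hb ▸ hz, haα, hbα, hbΓ⟩
  obtain ⟨z₀, hz₀, b, hb, haα, hbα, hbΓ⟩ := key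
  have heq : ∀ {L : Type u} [AddCommGroup L] [Module R L] {x y : L}, x ∈ ppow p α →
      x + y ∉ ppow p (α + 1) → x ∉ ppow p (α + 1) →
      pheight p (y + x) = min (α : WithTop Ordinal.{u}) (pheight p y) := fun {L} _ _ x y hx hxy hx' => by
    have h1 : pheight p x = α :=
      le_antisymm (not_lt.1 fun h => hx' (coe_lt_pheight.1 h)) (coe_le_pheight.2 hx)
    rw [add_comm, pheight_add_eq_min (h1 ▸ not_lt.1 fun h => hxy (coe_lt_pheight.1 h)), h1]
  refine ⟨z₀, hz₀, b, hb, fun z hz => ?_, fun z hz h => hbΓ (-z) (neg_mem hz) ?_⟩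
  · rw [heq haα (by rw [add_assoc]; exact hsα _ (add_mem hz₀ hz)) (hsα _ hz₀),
      heq hbα (hbΓ z hz) (by simpa using hbΓ 0 (zero_mem _)), hΓ.pheight_eq z hz]
  · rw [Prod.snd_neg, h, add_neg_cancel]
    exact zero_mem _

theorem exists_le_of_smul_mem (hp : Irreducible p) (hΓ : IsAdapted p C C' Γ X Y)
    (hC : IsPDBWrt p C) (hu : ∀ α : Ordinal.{u}, uHat p M α = uHat p N α)
    (huInf : uHatInf p M = uHatInf p N) {a : M} {h : N} (hah : (p • a, h) ∈ Γ) :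
    ∃ Γ', Γ ≤ Γ' ∧ IsAdapted p C C' Γ' X Y ∧ ∃ b, (a, b) ∈ Γ' := by
  by_cases ha : ∀ z ∈ Γ, z.1 ≠ a
  · obtain ⟨z₀, hz₀, b, hb, hh, hbΓ⟩ := hΓ.exists_partner hp hC hu huInf hah ha
    have hmem : (a + z₀.1, b) ∈ Γ ⊔ Submodule.span R {(a + z₀.1, b)} :=
      Submodule.mem_sup_right (Submodule.mem_span_singleton_self _)
    refine ⟨_, le_sup_left, hΓ.sup_span ?_ hΓ.left_mem hΓ.right_mem subset_rfl subset_rfl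
      (mem_hull_of_smul_mem_hull hp.ne_zero (hΓ.fst_mem_hull _ hb))
      (mem_hull_of_smul_mem_hull hp.ne_zero (hΓ.snd_mem_hull _ hb))
      (fun _ => Or.inl) (fun _ => Or.inl), b - z₀.2, ?_⟩
    · exact hΓ.sup_span_of_smul_mem hp hb hh
        (fun z hz h => ha _ (sub_mem hz hz₀) (by rw [Prod.fst_sub, h, add_sub_cancel_right])) hbΓ
    · have := sub_mem hmem (Submodule.mem_sup_left hz₀)
      rwa [Prod.mk_sub_mk, add_sub_cancel_right] at this
  · push Not at ha
    obtain ⟨⟨_, b⟩, hz, rfl⟩ := ha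
    exact ⟨Γ, le_rfl, hΓ, b, hz⟩

theorem exists_le_of_pow_smul_mem (hp : Irreducible p) (hC : IsPDBWrt p C)
    (hu : ∀ α : Ordinal.{u}, uHat p M α = uHat p N α)
    (huInf : uHatInf p M = uHatInf p N) (k : ℕ) (hΓ : IsAdapted p C C' Γ X Y)
    {a : M} {h : N} (hah : (p ^ k • a, h) ∈ Γ) :
    ∃ Γ', Γ ≤ Γ' ∧ IsAdapted p C C' Γ' X Y ∧ ∃ b, (a, b) ∈ Γ' := by
  induction k generalizing Γ h with
  | zero => exact ⟨Γ, le_rfl, hΓ, h, by simpa using hah⟩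
  | succ k ih =>
    rw [pow_succ', mul_smul] at hah
    obtain ⟨Γ₁, h₁, hΓ₁, b, hb⟩ := hΓ.exists_le_of_smul_mem hp hC hu huInf hah
    obtain ⟨Γ₂, h₂, hΓ₂⟩ := ih hΓ₁ hb
    exact ⟨Γ₂, h₁.trans h₂, hΓ₂⟩

end IsAdapted

end Extension

section Insert

variable {R : Type v} [CommRing R] {M N : Type u} [AddCommGroup M] [Module R M]
  [AddCommGroup N] [Module R N] {p : R}

/-- A family of sets closed under passing to finite subsets and to nonzero scalar multiples of
elements. -/
def IsSMulClosed (R : Type v) [CommRing R] {M : Type u} [AddCommGroup M] [Module R M]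
    (C : Set (Set M)) : Prop :=
  ∀ X ∈ C, ∀ s : Finset M, ↑s ⊆ X → ∀ a : M → R, (∀ x ∈ s, a x ≠ 0) →
    ((fun x => a x • x) '' ↑s) ∈ C

theorem IsSMulClosed.insert_mem [Nontrivial R] {C : Set (Set M)} (hC : IsSMulClosed R C)
    {Z X : Set M} (hZ : Z ∈ C) {x : M} (hx : x ∉ X) (hXf : X.Finite) (hXZ : insert x X ⊆ Z)
    {r : R} (hr : r ≠ 0) : insert (r • x) X ∈ C := by
  classical
  have h := hC Z hZ (insert x hXf.toFinset) (by simpa using hXZ) (fun y => if y = x then r else 1)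
    (fun y _ => by split_ifs <;> simp [hr])
  rw [Finset.coe_insert, hXf.coe_toFinset, Set.image_insert_eq, if_pos rfl] at h
  convert h using 2
  refine (Set.image_id X).symm.trans (Set.image_congr fun y hy => ?_)
  have hyx : y ≠ x := fun h => hx (h ▸ hy)
  simp [hyx]

namespace IsAdapted

variable {C : Set (Set M)} {C' : Set (Set N)} {Γ : Submodule R (M × N)} {X : Set M} {Y : Set N}

theorem hasAtLeast_insert (hΓ : IsAdapted p C C' Γ X Y) (hC : IsPDBWrt p C)
    (hw : ∀ e : ℕ → WithTop Ordinal.{u}, IsUlmSeq e → wHat p C e = wHat p C' e)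
    {x : M} (hx : x ∉ X) (hxX : insert x X ∈ C) :
    ∃ n, (∃ Z ∈ C', HasAtLeast p (UlmSeqOf p x) (n + 1) Z) ∧
      ∀ t : Finset N, ↑t ⊆ Y → (∀ y ∈ t, UlmEquiv (UlmSeqOf p y) (UlmSeqOf p x)) → t.card ≤ n := by
  classical
  let s : Finset M := (hC.2.1 X hΓ.left_mem).toFinset.filter fun z =>
    UlmEquiv (UlmSeqOf p z) (UlmSeqOf p x)
  refine ⟨s.card, ?_, fun t ht hte => ?_⟩
  · rw [← coe_add_one_le_wHat_iff, ← hw _ (isUlmSeq_ulmSeqOf x), coe_add_one_le_wHat_iff]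
    refine ⟨_, hxX, insert x s, ?_, ?_, ?_⟩
    · rw [Finset.coe_insert]
      exact Set.insert_subset_insert fun z hz => by simp [s] at hz; exact hz.1
    · rw [Finset.card_insert_of_notMem (by simp [s, hx])]
    · intro z hz
      rcases Finset.mem_insert.1 hz with rfl | hz
      · exact UlmEquiv.refl _
      · exact (Finset.mem_filter.1 hz).2
  · choose! g hgX hg using hΓ.exists_left
    refine Finset.card_le_card_of_injOn g (fun y hy => ?_) fun y hy y' hy' hyy' => ?_
    · have hU : UlmSeqOf p (g y) = UlmSeqOf p y :=
        funext fun i => hΓ.pheight_eq _ (Γ.smul_mem (p ^ i) (hg y (ht hy)))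
      simp [s, hgX y (ht hy), hU, hte y hy]
    · have h := sub_mem (hg y (ht hy)) (hg y' (ht hy'))
      exact sub_eq_zero.1 ((hΓ.eq_zero_iff _ h).1 (by simpa [sub_eq_zero] using hyy'))

theorem exists_insert_right [IsDomain R] [IsDiscreteValuationRing R] (hp : Irreducible p)
    (hΓ : IsAdapted p C C' Γ X Y) (hC : IsPDBWrt p C)
    (hC' : IsPDBWrt p C') (hC'cl : IsSMulClosed R C')
    (hw : ∀ e : ℕ → WithTop Ordinal.{u}, IsUlmSeq e → wHat p C e = wHat p C' e)
    {x : M} (hx : x ∉ X) (hxX : insert x X ∈ C) :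
    ∃ y, y ∉ Y ∧ (∀ r : R, r ≠ 0 → insert (r • y) Y ∈ C') ∧
      UlmEquiv (UlmSeqOf p y) (UlmSeqOf p x) := by
  obtain ⟨n, ⟨Z, hZ, hn⟩, hY⟩ := hΓ.hasAtLeast_insert hC hw hx hxX
  obtain ⟨W, hW, hYW, t, htW, hnt, ht⟩ := hC'.exists_superset_hasAtLeast hp hΓ.right_mem hZ hn
  obtain ⟨y, hyt, hy⟩ : ∃ y ∈ t, y ∉ Y := by
    by_contra! htY
    exact absurd (hY t htY ht) (by omega)
  exact ⟨y, hy, fun r hr => hC'cl.insert_mem hW hy (hC'.2.1 Y hΓ.right_mem)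
    (Set.insert_subset (htW hyt) hYW) hr, ht y hyt⟩

end IsAdapted

variable [IsDomain R] [IsDiscreteValuationRing R]

theorem IsDecompWrt.eq_zero_of_mem_hull (hp : Irreducible p) {X : Set M} (hXf : X.Finite) {x : M}
    (hx : x ∉ X) (hX : IsDecompWrt p (insert x X)) {w : M} (hw : w ∈ hull (Submodule.span R X))
    {r : R} (h : w + r • x = 0) : r = 0 := by
  obtain ⟨k, hk⟩ := (mem_hull_iff hp).1 hw
  have := hX.eq_zero_of_add_smul_eq_zero hXf hx hk (r := p ^ k * r)
    (by rw [mul_smul, ← smul_add, h, smul_zero])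
  exact (mul_eq_zero.1 this).resolve_left (pow_ne_zero _ hp.ne_zero)

namespace IsAdapted

variable [Finite (R ⧸ Ideal.span {p})]

variable {C : Set (Set M)} {C' : Set (Set N)} {Γ : Submodule R (M × N)} {X : Set M} {Y : Set N}

theorem exists_le_insert (hp : Irreducible p) (hΓ : IsAdapted p C C' Γ X Y) (hC : IsPDBWrt p C)
    (hCcl : IsSMulClosed R C) (hC' : IsPDBWrt p C') (hC'cl : IsSMulClosed R C')
    (hw : ∀ e : ℕ → WithTop Ordinal.{u}, IsUlmSeq e → wHat p C e = wHat p C' e)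
    {x : M} (hx : x ∉ X) (hxX : insert x X ∈ C) :
    ∃ Γ', Γ ≤ Γ' ∧ ∃ (n : ℕ) (Y' : Set N), IsAdapted p C C' Γ' (insert (p ^ n • x) X) Y' := by
  have hXf := hC.2.1 X hΓ.left_mem
  have hYf := hC'.2.1 Y hΓ.right_mem
  obtain ⟨y, hy, hyY, n, m, hnm⟩ := hΓ.exists_insert_right hp hC hC' hC'cl hw hx hxX
  have hyY' : insert y Y ∈ C' := by simpa using hyY 1 one_ne_zero
  have hdX := hC.2.2.1 _ hxX
  have hdY := hC'.2.2.1 _ hyY'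
  obtain ⟨Nx, hNx⟩ := hdX.exists_separating hp hXf hx (hΓ.fg.map (LinearMap.fst R M N)) (by
    rintro _ ⟨z, hz, rfl⟩
    exact hΓ.fst_mem_hull z hz)
  obtain ⟨Ny, hNy⟩ := hdY.exists_separating hp hYf hy (hΓ.fg.map (LinearMap.snd R M N)) (by
    rintro _ ⟨z, hz, rfl⟩
    exact hΓ.snd_mem_hull z hz)
  have hU : UlmSeqOf p (p ^ (n + (Nx + Ny)) • x) = UlmSeqOf p (p ^ (m + (Nx + Ny)) • y) := by
    funext i
    have h := hnm (i + (Nx + Ny))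
    simp only [UlmSeqOf, smul_smul, ← pow_add] at h ⊢
    rw [show i + (n + (Nx + Ny)) = i + (Nx + Ny) + n by omega,
      show i + (m + (Nx + Ny)) = i + (Nx + Ny) + m by omega]
    exact h.symm
  have hpx : p ^ (n + (Nx + Ny)) ≠ 0 := pow_ne_zero _ hp.ne_zero
  have hpy : p ^ (m + (Nx + Ny)) ≠ 0 := pow_ne_zero _ hp.ne_zero
  refine ⟨_, le_sup_left, n + (Nx + Ny), insert (p ^ (m + (Nx + Ny)) • y) Y,
    hΓ.sup_span (hΓ.toIsHeightIso.sup_span (fun z hz r => ?_) fun z hz r => ?_)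
      (hCcl.insert_mem hxX hx hXf subset_rfl hpx) (hyY _ hpy)
      (Set.subset_insert _ _) (Set.subset_insert _ _)
      (subset_hull _ (Submodule.subset_span (Set.mem_insert _ _)))
      (subset_hull _ (Submodule.subset_span (Set.mem_insert _ _)))
      (fun z hz => hz.symm.imp_right fun h => ⟨h, Set.mem_insert _ _⟩)
      (fun z hz => hz.symm.imp_right fun h => ⟨h, Set.mem_insert _ _⟩)⟩
  · have h1 := hNx (r * p ^ (n + (Nx + Ny)))
      ((pow_dvd_pow p (by omega)).mul_left r) z.1 ⟨z, hz, rfl⟩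
    have h2 := hNy (r * p ^ (m + (Nx + Ny)))
      ((pow_dvd_pow p (by omega)).mul_left r) z.2 ⟨z, hz, rfl⟩
    rw [mul_smul, add_comm] at h1 h2
    rw [add_comm z.1, pheight_add_eq_min h1, add_comm z.2, pheight_add_eq_min h2,
      hΓ.pheight_eq z hz,
      pheight_smul_eq_of_ulmSeqOf_eq hp hU]
  · constructor <;> intro h
    · have hr := hdX.eq_zero_of_mem_hull hp hXf hx (hΓ.fst_mem_hull z hz)
        (r := r * p ^ (n + (Nx + Ny))) (by rwa [mul_smul])
      obtain rfl := (mul_eq_zero.1 hr).resolve_right hpx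
      simpa [hΓ.eq_zero_iff z hz] using h
    · have hr := hdY.eq_zero_of_mem_hull hp hYf hy (hΓ.snd_mem_hull z hz)
        (r := r * p ^ (m + (Nx + Ny))) (by rwa [mul_smul])
      obtain rfl := (mul_eq_zero.1 hr).resolve_right hpy
      simpa [← hΓ.eq_zero_iff z hz] using h

theorem exists_le_subset_hull (hp : Irreducible p) (hΓ : IsAdapted p C C' Γ X Y)
    (hC : IsPDBWrt p C) (hCcl : IsSMulClosed R C) (hC' : IsPDBWrt p C')
    (hC'cl : IsSMulClosed R C')
    (hw : ∀ e : ℕ → WithTop Ordinal.{u}, IsUlmSeq e → wHat p C e = wHat p C' e)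
    {Z : Set M} (hZ : Z ∈ C) (hXZ : X ⊆ Z) :
    ∃ Γ' X' Y', Γ ≤ Γ' ∧ X ⊆ X' ∧ IsAdapted p C C' Γ' X' Y' ∧
      Z ⊆ hull (Submodule.span R X') := by
  induction hn : (Z \ X).ncard using Nat.strong_induction_on generalizing Γ X Y Z with
  | _ n ih =>
  by_cases hZX : Z ⊆ X
  · exact ⟨Γ, X, Y, le_rfl, subset_rfl, hΓ,
      hZX.trans (Submodule.subset_span.trans (subset_hull _))⟩
  obtain ⟨x, hxZ, hx⟩ := Set.not_subset.1 hZX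
  have hXf := hC.2.1 X hΓ.left_mem
  have hZf := hC.2.1 Z hZ
  have hxX := hCcl.insert_mem hZ hx hXf (Set.insert_subset hxZ hXZ) one_ne_zero
  rw [one_smul] at hxX
  obtain ⟨Γ₁, h₁, m, Y₁, hΓ₁⟩ := hΓ.exists_le_insert hp hC hCcl hC' hC'cl hw hx hxX
  have hpm : p ^ m ≠ 0 := pow_ne_zero _ hp.ne_zero
  have hZ₁ : insert (p ^ m • x) (Z \ {x}) ∈ C := hCcl.insert_mem hZ (by simp) hZf.sdiff
    (Set.insert_subset hxZ Set.sdiff_subset) hpm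
  obtain ⟨Γ₂, X₂, Y₂, h₂, hX₂, hΓ₂, hZX₂⟩ := ih _ (by
      rw [← hn]
      refine Set.ncard_lt_ncard (Set.ssubset_iff_of_subset ?_ |>.2 ⟨x, ⟨hxZ, hx⟩, ?_⟩) hZf.sdiff
      · rintro z ⟨rfl | hz, hzX⟩
        · exact absurd (Set.mem_insert _ _) hzX
        · exact ⟨hz.1, fun h => hzX (Set.mem_insert_of_mem _ h)⟩
      · rintro ⟨h | h, hxX⟩
        · exact hxX (h ▸ Set.mem_insert _ _)
        · exact h.2 rfl) hΓ₁ hZ₁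
    (Set.insert_subset_insert fun z hz => ⟨hXZ hz, fun h => hx (h ▸ hz)⟩) rfl
  refine ⟨Γ₂, X₂, Y₂, h₁.trans h₂, (Set.subset_insert _ _).trans hX₂, hΓ₂, fun z hz => ?_⟩
  by_cases hzx : z = x
  · exact hzx ▸ mem_hull_of_smul_mem_hull hpm (hZX₂ (Set.mem_insert _ _))
  · exact hZX₂ (Set.mem_insert_of_mem _ ⟨hz, hzx⟩)

theorem exists_le_mem (hp : Irreducible p) (hΓ : IsAdapted p C C' Γ X Y)
    (hC : IsPDBWrt p C) (hCcl : IsSMulClosed R C) (hC' : IsPDBWrt p C')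
    (hC'cl : IsSMulClosed R C')
    (hw : ∀ e : ℕ → WithTop Ordinal.{u}, IsUlmSeq e → wHat p C e = wHat p C' e)
    (hu : ∀ α : Ordinal.{u}, uHat p M α = uHat p N α) (huInf : uHatInf p M = uHatInf p N)
    (a : M) :
    ∃ Γ' X' Y', Γ ≤ Γ' ∧ X ⊆ X' ∧ IsAdapted p C C' Γ' X' Y' ∧ ∃ b, (a, b) ∈ Γ' := by
  obtain ⟨Z, hZ, hXZ, haZ⟩ := hC.2.2.2 X hΓ.left_mem a
  obtain ⟨Γ₁, X₁, Y₁, h₁, hX₁, hΓ₁, hZX₁⟩ :=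
    hΓ.exists_le_subset_hull hp hC hCcl hC' hC'cl hw hZ hXZ
  have hspan : ∀ z ∈ Submodule.span R Z, z ∈ hull (Submodule.span R X₁) := fun z hz => by
    induction hz using Submodule.span_induction with
    | mem z hz => exact hZX₁ hz
    | zero => exact subset_hull _ (zero_mem _)
    | add x y _ _ hx hy => exact add_mem_hull hx hy
    | smul r x _ hx => exact smul_mem_hull r hx
  obtain ⟨r, hr, hra⟩ := haZ
  obtain ⟨k, hk⟩ := (mem_hull_iff hp).1 (mem_hull_of_smul_mem_hull hr (hspan _ hra))
  have hdom : Submodule.span R X₁ ≤ Γ₁.map (LinearMap.fst R M N) :=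
    Submodule.span_le.2 fun x hx => by
      obtain ⟨y, -, hxy⟩ := hΓ₁.exists_right x hx
      exact ⟨_, hxy, rfl⟩
  obtain ⟨⟨_, h⟩, hz, rfl⟩ := hdom hk
  obtain ⟨Γ₂, h₂, hΓ₂, hb⟩ := hΓ₁.exists_le_of_pow_smul_mem hp hC hu huInf k hz
  exact ⟨Γ₂, X₁, Y₁, h₁.trans h₂, hX₁, hΓ₂, hb⟩

end IsAdapted

end Insert

section System

variable {R : Type v} [CommRing R] {M N : Type u} [AddCommGroup M] [Module R M]
  [AddCommGroup N] [Module R N] {p : R} {C : Set (Set M)} {C' : Set (Set N)}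

theorem IsHeightIso.graph_toLinearPMap {Γ : Submodule R (M × N)} (hΓ : IsHeightIso p Γ) :
    Γ.toLinearPMap.graph = Γ :=
  Γ.toLinearPMap_graph_eq fun z hz => (hΓ.eq_zero_iff z hz).1

theorem isAdapted_graph_iff {f : M →ₗ.[R] N} {X : Set M} {Y : Set N} :
    IsAdapted p C C' f.graph X Y ↔ X ∈ C ∧ Y ∈ C' ∧
      f.domain.FG ∧ (LinearMap.range f.toFun).FG ∧
      Function.Injective f.toFun ∧
      (∀ z : f.domain, pheight p (f z) = pheight p (z : M)) ∧
      X ⊆ (f.domain : Set M) ∧ (f.domain : Set M) ⊆ hull (Submodule.span R X) ∧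
      Y ⊆ {h | ∃ z : f.domain, f z = h} ∧
      {h | ∃ z : f.domain, f z = h} ⊆ hull (Submodule.span R Y) ∧
      {h | ∃ z : f.domain, (z : M) ∈ X ∧ f z = h} = Y := by
  constructor
  · intro h
    refine ⟨h.left_mem, h.right_mem, ?_, ?_, ?_, ?_, ?_, ?_, ?_, ?_, ?_⟩
    · rw [← f.graph_map_fst_eq_domain]
      exact h.fg.map _
    · rw [← f.graph_map_snd_eq_range]
      exact h.fg.map _
    · rw [← LinearMap.ker_eq_bot, LinearMap.ker_eq_bot']
      exact fun z hz => Subtype.ext ((h.eq_zero_iff _ (f.mem_graph z)).2 hz)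
    · exact fun z => (h.pheight_eq _ (f.mem_graph z)).symm
    · intro x hx
      obtain ⟨y, -, hxy⟩ := h.exists_right x hx
      exact LinearPMap.mem_domain_of_mem_graph hxy
    · exact fun x hx => h.fst_mem_hull _ (f.mem_graph ⟨x, hx⟩)
    · intro y hy
      obtain ⟨x, -, hxy⟩ := h.exists_left y hy
      obtain ⟨z, -, hz⟩ := f.mem_graph_iff.1 hxy
      exact ⟨z, hz⟩
    · rintro _ ⟨z, rfl⟩
      exact h.snd_mem_hull _ (f.mem_graph z)
    · ext y
      constructor
      · rintro ⟨z, hz, rfl⟩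
        obtain ⟨y, hy, hzy⟩ := h.exists_right z hz
        rwa [f.mem_graph_snd_inj (f.mem_graph z) hzy rfl]
      · intro hy
        obtain ⟨x, hx, hxy⟩ := h.exists_left y hy
        obtain ⟨z, rfl, hz⟩ := f.mem_graph_iff.1 hxy
        exact ⟨z, hx, hz⟩
  · rintro ⟨hX, hY, hfg, -, hinj, hh, hXd, hd, -, hr, hXY⟩
    refine ⟨⟨?_, ?_, ?_⟩, hX, hY, ?_, ?_, ?_, ?_⟩
    · rw [show f.graph = LinearMap.range (f.domain.subtype.prod f.toFun) by
        ext ⟨x, y⟩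
        simp, LinearMap.range_eq_map]
      exact ((Submodule.fg_top _).2 hfg).map _
    · intro z hz
      obtain ⟨w, h₁, h₂⟩ := f.mem_graph_iff.1 hz
      rw [← h₁, ← h₂, hh]
    · intro z hz
      obtain ⟨w, h₁, h₂⟩ := f.mem_graph_iff.1 hz
      rw [← h₁, ← h₂, ZeroMemClass.coe_eq_zero]
      exact (map_eq_zero_iff f.toFun hinj).symm
    · intro z hz
      exact hd (LinearPMap.mem_domain_of_mem_graph hz)
    · intro z hz
      obtain ⟨w, -, h₂⟩ := f.mem_graph_iff.1 hz
      exact hr ⟨w, h₂⟩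
    · exact fun x hx => ⟨_, hXY.le ⟨⟨x, hXd hx⟩, hx, rfl⟩, f.mem_graph ⟨x, hXd hx⟩⟩
    · intro y hy
      obtain ⟨z, hz, rfl⟩ := hXY.ge hy
      exact ⟨z, hz, f.mem_graph z⟩

variable [IsDomain R] [IsDiscreteValuationRing R]

theorem exists_isAdapted_of_bijOn (hp : Irreducible p) (hC : IsPDBWrt p C) (hC' : IsPDBWrt p C')
    {X : Set M} (hX : X ∈ C) {Y : Set N} (hY : Y ∈ C') {f : M → N} (hf : Set.BijOn f X Y)
    (hfU : ∀ x ∈ X, UlmSeqOf p (f x) = UlmSeqOf p x) :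
    ∃ Γ, IsAdapted p C C' Γ X Y ∧ ∀ x ∈ X, (x, f x) ∈ Γ := by
  have := (hC.2.1 X hX).fintype
  have := (hC'.2.1 Y hY).fintype
  have hdX := hC.2.2.1 X hX
  have hdY := hC'.2.2.1 Y hY
  let e : X ≃ Y := hf.equiv f
  let Γ : Submodule R (M × N) := Submodule.span R (Set.range fun x : X => ((x : M), f x))
  have hmem : ∀ x ∈ X, (x, f x) ∈ Γ := fun x hx => Submodule.subset_span ⟨⟨x, hx⟩, rfl⟩
  have hΓ : ∀ z ∈ Γ, ∃ c : X → R, z.1 = ∑ x, c x • (x : M) ∧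
      z.2 = ∑ y, c (e.symm y) • (y : N) := by
    intro z hz
    obtain ⟨c, rfl⟩ := (Submodule.mem_span_range_iff_exists_fun R).1 hz
    refine ⟨c, by simp [Prod.fst_sum], ?_⟩
    rw [← e.sum_comp]
    simp [Prod.snd_sum, e, Set.BijOn.equiv]
  refine ⟨Γ, ⟨⟨Submodule.fg_span (Set.finite_range _), fun z hz => ?_, fun z hz => ?_⟩, hX, hY,
    fun z hz => ?_, fun z hz => ?_, fun x hx => ⟨f x, hf.mapsTo hx, hmem x hx⟩, fun y hy => ?_⟩,
    hmem⟩
  · obtain ⟨c, h₁, h₂⟩ := hΓ z hz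
    rw [h₁, h₂]
    refine eq_of_forall_le_iff fun h => ?_
    rw [hdX.le_pheight_sum_iff, hdY.le_pheight_sum_iff, ← e.forall_congr_right]
    refine forall_congr' fun x => ?_
    rw [e.symm_apply_apply, pheight_smul_eq_of_ulmSeqOf_eq hp (hfU x x.2).symm]
    rfl
  · obtain ⟨c, h₁, h₂⟩ := hΓ z hz
    rw [h₁, h₂]
    constructor <;> intro h
    · have := Fintype.linearIndependent_iff.1 hdX.1 c h
      simp [this]
    · have := Fintype.linearIndependent_iff.1 hdY.1 _ h
      refine Finset.sum_eq_zero fun x _ => ?_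
      have hx := this (e x)
      rw [e.symm_apply_apply] at hx
      rw [hx, zero_smul]
  · obtain ⟨c, h₁, -⟩ := hΓ z hz
    exact subset_hull _ (mem_span_iff_exists_sum.2 ⟨c, h₁.symm⟩)
  · obtain ⟨c, -, h₂⟩ := hΓ z hz
    exact subset_hull _ (mem_span_iff_exists_sum.2 ⟨_, h₂.symm⟩)
  · obtain ⟨x, hx, rfl⟩ := hf.surjOn hy
    exact ⟨x, hx, hmem x hx⟩

/-- The height-preserving isomorphisms which match members of two partial decomposition bases and
extend a given one form a partial isomorphism system. -/
theorem isPartialIsoSystem_of_invariants [Finite (R ⧸ Ideal.span {p})] (hp : Irreducible p)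
    (hC : IsPDBWrt p C) (hCcl : IsSMulClosed R C) (hC' : IsPDBWrt p C')
    (hC'cl : IsSMulClosed R C') (hu : ∀ α : Ordinal.{u}, uHat p M α = uHat p N α)
    (huInf : uHatInf p M = uHatInf p N)
    (hw : ∀ e : ℕ → WithTop Ordinal.{u}, IsUlmSeq e → wHat p C e = wHat p C' e)
    {X₀ : Set M} (hX₀ : X₀ ∈ C) {Y₀ : Set N} (hY₀ : Y₀ ∈ C') {f₀ : M → N}
    (hf₀ : Set.BijOn f₀ X₀ Y₀) (hf₀U : ∀ x ∈ X₀, UlmSeqOf p (f₀ x) = UlmSeqOf p x) :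
    IsPartialIsoSystem {f : M →ₗ.[R] N | ∃ X Y, IsAdapted p C C' f.graph X Y ∧
      X₀ ⊆ X ∧ ∀ x ∈ X₀, (x, f₀ x) ∈ f.graph} := by
  refine ⟨?_, ?_, ?_, ?_⟩
  · obtain ⟨Γ, hΓ, hmem⟩ := exists_isAdapted_of_bijOn hp hC hC' hX₀ hY₀ hf₀ hf₀U
    have hg := hΓ.graph_toLinearPMap
    exact ⟨Γ.toLinearPMap, X₀, Y₀, hg.symm ▸ hΓ, subset_rfl, hg.symm ▸ hmem⟩
  · rintro f ⟨X, Y, h, -⟩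
    exact (isAdapted_graph_iff.1 h).2.2.2.2.1
  · rintro f ⟨X, Y, h, hX, hf⟩ a
    obtain ⟨Γ, X', Y', hle, hXX', hΓ, b, hb⟩ :=
      h.exists_le_mem hp hC hCcl hC' hC'cl hw hu huInf a
    have hg := hΓ.graph_toLinearPMap
    refine ⟨Γ.toLinearPMap, ⟨X', Y', hg.symm ▸ hΓ, hX.trans hXX', ?_⟩, ?_, ?_⟩
    · rw [hg]
      exact fun x hx => hle (hf x hx)
    · exact LinearPMap.le_of_le_graph (hg.symm ▸ hle)
    · exact LinearPMap.mem_domain_of_mem_graph (hg.symm ▸ hb)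
  · rintro f ⟨X, Y, h, hX, hf⟩ b
    obtain ⟨Γ', Y', X', hle', hYY', hΓ', a, ha'⟩ := h.swap.exists_le_mem hp hC' hC'cl hC hCcl
      (fun e he => (hw e he).symm) (fun α => (hu α).symm) huInf.symm b
    have hΓ := hΓ'.swap
    have hle : f.graph ≤ Γ'.map (LinearEquiv.prodComm R N M).toLinearMap :=
      fun z hz => ⟨_, hle' ⟨z, hz, rfl⟩, rfl⟩
    have ha : (a, b) ∈ Γ'.map (LinearEquiv.prodComm R N M).toLinearMap := ⟨_, ha', rfl⟩
    have hg := hΓ.graph_toLinearPMap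
    refine ⟨_, ⟨X', Y', hg.symm ▸ hΓ, fun x hx => ?_, ?_⟩, LinearPMap.le_of_le_graph
      (hg.symm ▸ hle), ?_⟩
    · obtain ⟨y, hy, hxy⟩ := h.exists_right x (hX hx)
      obtain ⟨x', hx', hxy'⟩ := hΓ.exists_left y (hYY' hy)
      have hsub := hΓ.eq_zero_iff _ (Submodule.sub_mem _ (hle hxy) hxy')
      have hxx' : x = x' := by simpa [sub_eq_zero] using hsub
      rwa [hxx']
    · rw [hg]
      exact fun x hx => hle (hf x hx)
    · rw [← hg] at ha
      obtain ⟨y, -, hy⟩ := (LinearPMap.mem_graph_iff _).1 ha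
      exact ⟨y, hy⟩

end System

section Zp

variable (p : ℤ) [hp : Fact (Prime p)]

theorem span_intPrime_ne_bot : (Ideal.span {p} : Ideal ℤ) ≠ ⊥ := by
  simpa using hp.out.ne_zero

theorem isDiscreteValuationRing_Zp : IsDiscreteValuationRing (Zp p) :=
  IsLocalization.AtPrime.isDiscreteValuationRing_of_dedekind_domain ℤ (span_intPrime_ne_bot p) _

theorem maximalIdeal_Zp : IsLocalRing.maximalIdeal (Zp p) = Ideal.span {(p : Zp p)} := by
  rw [← Localization.AtPrime.map_eq_maximalIdeal, Ideal.map_span, Set.image_singleton, eq_intCast]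

theorem irreducible_Zp : Irreducible (p : Zp p) := by
  have := isDiscreteValuationRing_Zp p
  exact (IsDiscreteValuationRing.irreducible_iff_uniformizer _).2 (maximalIdeal_Zp p)

theorem finite_quotient_Zp : Finite (Zp p ⧸ Ideal.span {(p : Zp p)}) := by
  have : (Ideal.span {p} : Ideal ℤ).IsMaximal :=
    Ideal.IsPrime.isMaximal inferInstance (span_intPrime_ne_bot p)
  have : Finite (ℤ ⧸ Ideal.span {p}) :=
    Ideal.finiteQuotientOfFreeOfNeBot _ (span_intPrime_ne_bot p)
  rw [← maximalIdeal_Zp]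
  exact Finite.of_equiv _
    (IsLocalization.AtPrime.equivQuotMaximalIdeal (Ideal.span {p}) (Zp p)).toEquiv

end Zp

end UlmW

universe u

open UlmW

theorem statement_14 (p : ℤ) [Fact (Prime p)] {G H : Type u} [AddCommGroup G]
    [Module (Zp p) G] [AddCommGroup H] [Module (Zp p) H]
    (C : Set (Set G)) (hC : IsPDBWrt (p : Zp p) C)
    (hCcl : ∀ X ∈ C, ∀ s : Finset G, ↑s ⊆ X → ∀ a : G → Zp p,
      (∀ x ∈ s, a x ≠ 0) → ((fun x => a x • x) '' ↑s) ∈ C)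
    (C' : Set (Set H)) (hC' : IsPDBWrt (p : Zp p) C')
    (hC'cl : ∀ Y ∈ C', ∀ s : Finset H, ↑s ⊆ Y → ∀ a : H → Zp p,
      (∀ y ∈ s, a y ≠ 0) → ((fun y => a y • y) '' ↑s) ∈ C')
    (hu : ∀ α : Ordinal.{u}, uHat (p : Zp p) G α = uHat (p : Zp p) H α)
    (huInf : uHatInf (p : Zp p) G = uHatInf (p : Zp p) H)
    (hw : ∀ e : ℕ → WithTop Ordinal.{u}, IsUlmSeq e →
      wHat (p : Zp p) C e = wHat (p : Zp p) C' e)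
    (X₀ : Set G) (hX₀ : X₀ ∈ C) (Y₀ : Set H) (hY₀ : Y₀ ∈ C')
    (f₀ : G → H) (hbij : Set.BijOn f₀ X₀ Y₀)
    (hf₀U : ∀ x ∈ X₀, UlmSeqOf (p : Zp p) (f₀ x) = UlmSeqOf (p : Zp p) x) :
    IsPartialIsoSystem
      {f : G →ₗ.[Zp p] H | ∃ X ∈ C, ∃ Y ∈ C',
        f.domain.FG ∧ (LinearMap.range f.toFun).FG ∧
        Function.Injective f.toFun ∧
        (∀ z : f.domain, pheight (p : Zp p) (f z) = pheight (p : Zp p) (z : G)) ∧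
        X ⊆ (f.domain : Set G) ∧ (f.domain : Set G) ⊆ hull (Submodule.span (Zp p) X) ∧
        Y ⊆ {h | ∃ z : f.domain, f z = h} ∧
        {h | ∃ z : f.domain, f z = h} ⊆ hull (Submodule.span (Zp p) Y) ∧
        {h | ∃ z : f.domain, (z : G) ∈ X ∧ f z = h} = Y ∧
        X₀ ⊆ X ∧ ∀ x ∈ X₀, ∃ hx : x ∈ f.domain, f ⟨x, hx⟩ = f₀ x} := by
  have := isDiscreteValuationRing_Zp p
  have := finite_quotient_Zp p
  convert isPartialIsoSystem_of_invariants (irreducible_Zp p) hC hCcl hC' hC'cl hu huInf hw hX₀ hY₀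
    hbij hf₀U using 1
  ext f
  simp only [Set.mem_ofPred_eq, isAdapted_graph_iff, LinearPMap.mem_graph_iff, Subtype.exists]
  constructor
  · rintro ⟨X, hX, Y, hY, h₁, h₂, h₃, h₄, h₅, h₆, h₇, h₈, h₉, h₁₀, h₁₁⟩
    refine ⟨X, Y, ⟨hX, hY, h₁, h₂, h₃, h₄, h₅, h₆, h₇, h₈, h₉⟩, h₁₀, fun x hx => ?_⟩
    obtain ⟨hxf, hfx⟩ := h₁₁ x hx
    exact ⟨x, hxf, rfl, hfx⟩
  · rintro ⟨X, Y, ⟨hX, hY, h₁, h₂, h₃, h₄, h₅, h₆, h₇, h₈, h₉⟩, h₁₀, h₁₁⟩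
    refine ⟨X, hX, Y, hY, h₁, h₂, h₃, h₄, h₅, h₆, h₇, h₈, h₉, h₁₀, fun x hx => ?_⟩
    obtain ⟨_, hxf, rfl, hfx⟩ := h₁₁ x hx
    exact ⟨hxf, hfx⟩

end
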